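/- arXiv:1811.09650 — 5 statements merged into one kernel-verified Lean document; each statement's English description precedes it below -/
import Mathlib

section
/- There exist a first-order language with finitely many symbols, all of which are relation symbols, and a Fraïssé class 𝓕 of finite structures in this language with Fraïssé limit U, such that: (i) every finite group is isomorphic to a subgroup of Aut(U), and (ii) Aut(U) is not universal, i.e., there exists a countable structure M, all of whose finite substructures belong to 𝓕, such that Aut(M) is not isomorphic to any subgroup of Aut(U). -/
open FirstOrder CategoryTheory

/-- The automorphism group of a first-order structure, with multiplication given by
composition of automorphisms. -/
instance autGroup {L : FirstOrder.Language} {M : Type*} [L.Structure M] :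
    Group (M ≃[L] M) where
  mul f g := f.comp g
  one := FirstOrder.Language.Equiv.refl L M
  inv f := f.symm
  mul_assoc _ _ _ := rfl
  one_mul := FirstOrder.Language.Equiv.refl_comp
  mul_one := FirstOrder.Language.Equiv.comp_refl
  inv_mul_cancel := FirstOrder.Language.Equiv.symm_comp_self

open FirstOrder.Language

namespace LocalTournament

/-- A ternary relation `r` such that each `r q` is a reflexive tournament on some set of points
different from `q`. -/
structure IsLocalTournament {N : Type*} (r : N → N → N → Prop) : Prop where
  ne : ∀ {q x}, r q x x → q ≠ x
  left : ∀ {q x y}, r q x y → r q x x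
  right : ∀ {q x y}, r q x y → r q y y
  xor : ∀ {q x y}, r q x x → r q y y → x ≠ y → (r q x y ↔ ¬ r q y x)

/-- To check that an injective map preserves local tournaments in both directions, it suffices to
compare the domains of the tournaments and to check that arcs are mapped to arcs. -/
theorem IsLocalTournament.map_iff {N W : Type*} {r : N → N → N → Prop} {r' : W → W → W → Prop}
    (hr : IsLocalTournament r) (hr' : IsLocalTournament r') {T : Set N} {g : N → W}
    (hg : Set.InjOn g T)
    (hdom : ∀ q ∈ T, ∀ x ∈ T, (r q x x ↔ r' (g q) (g x) (g x)))
    (harc : ∀ q ∈ T, ∀ x ∈ T, ∀ y ∈ T, x ≠ y → r q x x → r q y y → r q x y →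
      r' (g q) (g x) (g y))
    {q x y : N} (hq : q ∈ T) (hx : x ∈ T) (hy : y ∈ T) :
    r q x y ↔ r' (g q) (g x) (g y) := by
  rcases eq_or_ne x y with rfl | hxy
  · exact hdom q hq x hx
  · refine ⟨fun h => harc q hq x hx y hy hxy (hr.left h) (hr.right h) h, fun h => ?_⟩
    have hx' := (hdom q hq x hx).2 (hr'.left h)
    have hy' := (hdom q hq y hy).2 (hr'.right h)
    by_contra hn
    have hyx : r q y x := (hr.xor hy' hx' hxy.symm).2 hn
    exact (hr'.xor (hr'.left h) (hr'.right h) fun e => hxy (hg hx hy e)).1 h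
      (harc q hq y hy x hx hxy.symm hy' hx' hyx)

/-- The tournament which agrees with `s` on the pairs that are increasing with respect to `i`. -/
def orient {W : Type} (i : W → ℕ) (s : W → W → Prop) (x y : W) : Prop :=
  (i x < i y ∧ s x y) ∨ (i y ≤ i x ∧ ¬ s y x)

theorem orient_xor {W : Type} {i : W → ℕ} (hi : Function.Injective i) (s : W → W → Prop)
    {x y : W} (h : x ≠ y) : orient i s x y ↔ ¬ orient i s y x := by
  have := hi.ne h
  rcases lt_or_gt_of_ne this with h | h <;> simp [orient, h, h.le, not_lt.2 h.le, not_le.2 h]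

section FreeAction

variable {G : Type} [Group G]

/-- The free action of `G` on `G × ℕ` by left multiplication on the first coordinate. -/
def act (g : G) (x : G × ℕ) : G × ℕ := (g * x.1, x.2)

theorem act_mul (g h : G) (x : G × ℕ) : act (g * h) x = act g (act h x) := by
  simp [act, mul_assoc]

theorem act_one (x : G × ℕ) : act 1 x = x := by simp [act]

theorem act_injective (g : G) : Function.Injective (act g) := fun x y h => by
  simpa [act, Prod.ext_iff] using h

/-- Finite information about a new point: which old points belong to its tournament, to whose
tournaments it belongs, which arcs its tournament has, and to which points it has an arc in
the tournaments of the old points. -/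
abbrev PointType (G : Type) : Type :=
  Finset (G × ℕ) × Finset (G × ℕ) × Finset ((G × ℕ) × (G × ℕ)) × Finset ((G × ℕ) × (G × ℕ))

theorem exists_recurrent_sequence (C : Type) [Countable C] [Nonempty C] :
    ∃ c : ℕ → C, ∀ t N, ∃ n, N ≤ n ∧ c n = t := by
  obtain ⟨f, hf⟩ := exists_surjective_nat C
  refine ⟨fun n => f n.unpair.1, fun t N => ?_⟩
  obtain ⟨k, rfl⟩ := hf t
  exact ⟨Nat.pair k N, Nat.right_le_pair _ _, by simp⟩

variable (c : ℕ → PointType G) (i : G × ℕ → ℕ)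

/-- The domain of the tournament attached to the point `(1, m)`. -/
def baseDom (m : ℕ) (x : G × ℕ) : Prop :=
  (x.2 ≤ m ∧ x ∈ (c m).1) ∨ (m < x.2 ∧ (x.1⁻¹, m) ∈ (c x.2).2.1)

open Classical in
/-- The relation which is made into the tournament attached to the point `(1, m)`. -/
def baseArc (m : ℕ) (x y : G × ℕ) : Prop :=
  if x.2 ≤ m ∧ y.2 ≤ m then (x, y) ∈ (c m).2.2.1
  else if y.2 < x.2 then ((x.1⁻¹, m), act x.1⁻¹ y) ∈ (c x.2).2.2.2
  else ((y.1⁻¹, m), act y.1⁻¹ x) ∉ (c y.2).2.2.2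

/-- The domains of the tournaments attached to arbitrary points, by translation. -/
def dom (q x : G × ℕ) : Prop := baseDom c q.2 (act q.1⁻¹ x)

/-- The tournaments attached to arbitrary points, by translation. -/
def arc (q x y : G × ℕ) : Prop :=
  orient i (baseArc c q.2) (act q.1⁻¹ x) (act q.1⁻¹ y)

/-- The generic `G`-invariant local tournament. -/
def rel (q x y : G × ℕ) : Prop :=
  q ≠ x ∧ q ≠ y ∧ dom c q x ∧ dom c q y ∧ (x = y ∨ arc c i q x y)

theorem rel_self {q x : G × ℕ} : rel c i q x x ↔ q ≠ x ∧ dom c q x := by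
  simp only [rel]; tauto

theorem isLocalTournament_rel {i : G × ℕ → ℕ} (hi : Function.Injective i) :
    IsLocalTournament (rel c i) where
  ne h := h.1
  left h := (rel_self c i).2 ⟨h.1, h.2.2.1⟩
  right h := (rel_self c i).2 ⟨h.2.1, h.2.2.2.1⟩
  xor {q x y} hx hy hxy := by
    rw [rel_self] at hx hy
    have := orient_xor hi (baseArc c q.2) ((act_injective q.1⁻¹).ne hxy)
    simp only [rel, hx, hy, hxy, hxy.symm, arc, this, ne_eq, not_false_eq_true, true_and,
      false_or]

theorem rel_act (g : G) (q x y : G × ℕ) :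
    rel c i (act g q) (act g x) (act g y) ↔ rel c i q x y := by
  have h : ∀ z, act (act g q).1⁻¹ (act g z) = act q.1⁻¹ z := fun z => by
    simp [act, mul_assoc]
  have h2 : (act g q).2 = q.2 := rfl
  simp only [rel, dom, arc, h, h2, (act_injective g).eq_iff, (act_injective g).ne_iff]

variable {c i}

/-- Every prescribed finite behaviour is realized by some new point. -/
theorem exists_point (hc : ∀ t N, ∃ n, N ≤ n ∧ c n = t) (hi : Function.Injective i)
    (A : Finset (G × ℕ)) (P₁ P₂ : G × ℕ → Prop) (Q₁ Q₂ : G × ℕ → G × ℕ → Prop) :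
    ∃ b ∉ A, (∀ x ∈ A, dom c b x ↔ P₁ x) ∧ (∀ x ∈ A, dom c x b ↔ P₂ x) ∧
      (∀ x ∈ A, ∀ y ∈ A, arc c i b x y ↔ orient i Q₁ x y) ∧
      (∀ q ∈ A, ∀ x ∈ A, arc c i q b x ↔ Q₂ q x) ∧
      (∀ q ∈ A, ∀ x ∈ A, arc c i q x b ↔ ¬ Q₂ q x) := by
  classical
  obtain ⟨n, hn, hcn⟩ := hc (A.filter P₁, A.filter P₂, (A ×ˢ A).filter (fun p => Q₁ p.1 p.2),
    (A ×ˢ A).filter (fun p => Q₂ p.1 p.2)) (A.sup Prod.snd + 1)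
  have hlt : ∀ x ∈ A, x.2 < n := fun x hx =>
    lt_of_lt_of_le (Nat.lt_succ_of_le (Finset.le_sup (f := Prod.snd) hx)) hn
  have key : ∀ q ∈ A, ∀ x ∈ A, arc c i q (1, n) x ↔ Q₂ q x := by
    intro q hq x hx
    have hq' := hlt q hq
    have hx' := hlt x hx
    have h1 : baseArc c q.2 (act q.1⁻¹ (1, n)) (act q.1⁻¹ x) ↔ Q₂ q x := by
      simp [baseArc, act, hcn, hx', hq, hx, not_le.2 hq']
    have h2 : baseArc c q.2 (act q.1⁻¹ x) (act q.1⁻¹ (1, n)) ↔ ¬ Q₂ q x := by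
      simp [baseArc, act, hcn, hq, hx, not_le.2 hq', not_lt.2 hx'.le]
    rw [arc, orient, h1, h2, not_not, ← or_and_right]
    simp [lt_or_ge]
  refine ⟨(1, n), fun h => lt_irrefl _ (hlt _ h), ?_, ?_, ?_, key, ?_⟩
  · intro x hx
    simp [dom, baseDom, act, hcn, hx, (hlt x hx).le, not_lt.2 (hlt x hx).le]
  · intro x hx
    simp [dom, baseDom, act, hcn, hx, (hlt x hx), not_le.2 (hlt x hx)]
  · intro x hx y hy
    simp [arc, orient, baseArc, act, hcn, hx, hy, (hlt x hx).le, (hlt y hy).le]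
  · intro q hq x hx
    have hne : x ≠ (1, n) := fun h => absurd (hlt x hx) (by simp [h])
    rw [← key q hq x hx]
    exact orient_xor hi _ ((act_injective q.1⁻¹).ne hne)

/-- One-point extension property of the generic invariant local tournament. -/
theorem exists_extension (hc : ∀ t N, ∃ n, N ≤ n ∧ c n = t) (hi : Function.Injective i)
    {N : Type*} [DecidableEq N] {r : N → N → N → Prop} (hr : IsLocalTournament r) {S : Set N}
    (hS : S.Finite)
    {f : N → G × ℕ} (hf : Set.InjOn f S)
    (hfr : ∀ q ∈ S, ∀ x ∈ S, ∀ y ∈ S, r q x y ↔ rel c i (f q) (f x) (f y)) {m : N} (hm : m ∉ S) :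
    ∃ b, Set.InjOn (Function.update f m b) (insert m S) ∧
      ∀ q ∈ insert m S, ∀ x ∈ insert m S, ∀ y ∈ insert m S, (r q x y ↔
        rel c i (Function.update f m b q) (Function.update f m b x) (Function.update f m b y)) := by
  classical
  have : Nonempty N := ⟨m⟩
  set ψ := Function.invFunOn f S
  have hψ : ∀ x ∈ S, ψ (f x) = x := fun x hx => hf.leftInvOn_invFunOn hx
  obtain ⟨b, hbA, h1, h2, h3, h4, h5⟩ := exists_point hc hi (hS.image f).toFinset
    (fun w => r m (ψ w) (ψ w)) (fun w => r (ψ w) m m) (fun w w' => r m (ψ w) (ψ w'))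
    (fun q w => r (ψ q) m (ψ w))
  have hmem : ∀ x ∈ S, f x ∈ (hS.image f).toFinset := fun x hx => by
    simpa using ⟨x, hx, rfl⟩
  have hne : ∀ x ∈ S, f x ≠ b := fun x hx h => hbA (h ▸ hmem x hx)
  have hfm : Function.update f m b m = b := by simp
  have hfS : ∀ x ∈ S, Function.update f m b x = f x := fun x hx =>
    Function.update_of_ne (fun h : x = m => hm (h ▸ hx)) _ _
  have hinj : Set.InjOn (Function.update f m b) (insert m S) := by
    rintro x (rfl | hx) y (rfl | hy) h
    · rfl
    · rw [hfm, hfS y hy] at h; exact absurd h.symm (hne y hy)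
    · rw [hfm, hfS x hx] at h; exact absurd h (hne x hx)
    · rw [hfS x hx, hfS y hy] at h; exact hf hx hy h
  have hrel := isLocalTournament_rel c hi
  refine ⟨b, hinj, fun _ h₁ _ h₂ _ h₃ => hr.map_iff hrel hinj ?_ ?_ h₁ h₂ h₃⟩
  · intro q hq x hx
    rcases hq with rfl | hq <;> rcases hx with rfl | hx
    · exact iff_of_false (fun h => hr.ne h rfl) fun h => hrel.ne h rfl
    · rw [hfm, hfS x hx, rel_self, h1 _ (hmem x hx), hψ x hx]
      simp [(hne x hx).symm]
    · rw [hfm, hfS q hq, rel_self, h2 _ (hmem q hq), hψ q hq]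
      simp [hne q hq]
    · rw [hfS q hq, hfS x hx]
      exact hfr q hq x hx x hx
  · intro q hq x hx y hy hxy hqx hqy hqxy
    rcases hq with rfl | hq
    · have hx := hx.resolve_left (hr.ne hqx).symm
      have hy := hy.resolve_left (hr.ne hqy).symm
      rw [hfm, hfS x hx, hfS y hy]
      refine ⟨(hne x hx).symm, (hne y hy).symm, ?_, ?_, Or.inr ?_⟩
      · rwa [h1 _ (hmem x hx), hψ x hx]
      · rwa [h1 _ (hmem y hy), hψ y hy]
      · rw [h3 _ (hmem x hx) _ (hmem y hy), orient, hψ x hx, hψ y hy]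
        rcases lt_or_ge (i (f x)) (i (f y)) with h | h
        · exact Or.inl ⟨h, hqxy⟩
        · exact Or.inr ⟨h, (hr.xor hqx hqy hxy).1 hqxy⟩
    · rcases hx with rfl | hx <;> rcases hy with rfl | hy
      · exact absurd rfl hxy
      · rw [hfm, hfS q hq, hfS y hy]
        refine ⟨hne q hq, ?_, ?_, ?_, Or.inr ?_⟩
        · exact fun h => hr.ne hqy (hf hq hy h)
        · rwa [h2 _ (hmem q hq), hψ q hq]
        · exact ((hfr q hq y hy y hy).1 hqy).2.2.1
        · rwa [h4 _ (hmem q hq) _ (hmem y hy), hψ q hq, hψ y hy]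
      · rw [hfm, hfS q hq, hfS x hx]
        refine ⟨?_, hne q hq, ?_, ?_, Or.inr ?_⟩
        · exact fun h => hr.ne hqx (hf hq hx h)
        · exact ((hfr q hq x hx x hx).1 hqx).2.2.1
        · rwa [h2 _ (hmem q hq), hψ q hq]
        · rw [h5 _ (hmem q hq) _ (hmem x hx), hψ q hq, hψ x hx]
          exact (hr.xor hqx hqy hxy).1 hqxy
      · rw [hfS q hq, hfS x hx, hfS y hy]
        exact (hfr q hq x hx y hy).1 hqxy

/-- Involutive automorphisms of the generic invariant local tournament have no fixed points,
apart from the identity. -/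
theorem eq_id_of_involutive (hc : ∀ t N, ∃ n, N ≤ n ∧ c n = t) (hi : Function.Injective i)
    {σ : G × ℕ → G × ℕ} (hσ : Function.Involutive σ)
    (hσr : ∀ q x y, rel c i (σ q) (σ x) (σ y) ↔ rel c i q x y) {q : G × ℕ} (hq : σ q = q)
    (x : G × ℕ) : σ x = x := by
  classical
  have hrel := isLocalTournament_rel c hi
  have hfix : ∀ z, rel c i q z z → σ z = z := by
    intro z hz
    by_contra hne
    have hz' : rel c i q (σ z) (σ z) := by
      have := (hσr q z z).2 hz
      rwa [hq] at this
    have h1 := hσr q z (σ z)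
    rw [hq, hσ z] at h1
    have h2 := hrel.xor hz hz' (Ne.symm hne)
    tauto
  by_contra hne
  obtain ⟨b, hbA, h1, h2, -⟩ := exists_point hc hi {q, x, σ x} (fun w => w = x)
    (fun _ => True) (fun _ _ => True) (fun _ _ => True)
  simp only [Finset.mem_insert, Finset.mem_singleton, not_or] at hbA
  have hb : σ b = b := hfix b ((rel_self c i).2 ⟨Ne.symm hbA.1, (h2 q (by simp)).2 trivial⟩)
  have hx : rel c i b x x := (rel_self c i).2 ⟨hbA.2.1, (h1 x (by simp)).2 rfl⟩
  have hy := (hσr b x x).2 hx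
  rw [hb, rel_self, h1 _ (by simp)] at hy
  exact hne hy.2

end FreeAction

/-- The only symbol of the language: a ternary relation symbol. -/
inductive TernarySymbol : ℕ → Type
  | rel : TernarySymbol 3

/-- The language with one ternary relation symbol. -/
def ternary : FirstOrder.Language.{0, 0} := ⟨fun _ => Empty, TernarySymbol⟩

instance : ternary.IsRelational := fun _ => inferInstanceAs (IsEmpty Empty)

theorem finite_symbols : Finite ternary.Symbols := by
  have : Finite (Σ n, ternary.Relations n) :=
    Finite.of_injective (β := Unit) (fun _ => ()) (by rintro ⟨_, ⟨⟩⟩ ⟨_, ⟨⟩⟩ _; rfl)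
  have : IsEmpty (Σ n, ternary.Functions n) := ⟨fun f => isEmptyElim f.2⟩
  exact inferInstanceAs (Finite ((Σ n, ternary.Functions n) ⊕ (Σ n, ternary.Relations n)))

/-- The structure given by a ternary relation. -/
@[reducible]
def structureOf {N : Type} (r : N → N → N → Prop) : ternary.Structure N where
  funMap f := isEmptyElim f
  RelMap | TernarySymbol.rel, v => r (v 0) (v 1) (v 2)

section Structures

variable {N W : Type} [ternary.Structure N] [ternary.Structure W]

/-- The ternary relation of a structure. -/
def tri (q x y : N) : Prop :=
  Structure.RelMap (L := ternary) (n := 3) TernarySymbol.rel ![q, x, y]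

/-- Injections preserving the ternary relations are embeddings. -/
def embeddingOf (e : N ↪ W) (he : ∀ q x y, tri (e q) (e x) (e y) ↔ tri q x y) :
    N ↪[ternary] W where
  toEmbedding := e
  map_fun' f := isEmptyElim f
  map_rel' := by
    rintro _ ⟨⟩ v
    have h := he (v 0) (v 1) (v 2)
    have h1 : ![v 0, v 1, v 2] = v := by ext j; fin_cases j <;> rfl
    have h2 : ![e (v 0), e (v 1), e (v 2)] = e ∘ v := by ext j; fin_cases j <;> rfl
    rw [tri, tri, h1, h2] at h
    exact h

/-- Bijections preserving the ternary relations are isomorphisms. -/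
def equivOf (e : N ≃ W) (he : ∀ q x y, tri (e q) (e x) (e y) ↔ tri q x y) :
    N ≃[ternary] W where
  toEquiv := e
  map_fun' f := isEmptyElim f
  map_rel' := (embeddingOf e.toEmbedding he).map_rel'

theorem embedding_tri (f : N ↪[ternary] W) (q x y : N) :
    tri (f q) (f x) (f y) ↔ tri q x y := by
  have h := f.map_rel (TernarySymbol.rel : ternary.Relations 3) ![q, x, y]
  have h2 : f ∘ ![q, x, y] = ![f q, f x, f y] := by ext j; fin_cases j <;> rfl
  rwa [h2] at h

theorem isExtensionPair_of_finite
    (h : ∀ (S : Set N) (f : N → W) (m : N), S.Finite → Set.InjOn f S →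
      (∀ q ∈ S, ∀ x ∈ S, ∀ y ∈ S, tri q x y ↔ tri (f q) (f x) (f y)) → m ∉ S →
      ∃ f' : N → W, Set.EqOn f' f S ∧ Set.InjOn f' (insert m S) ∧
        ∀ q ∈ insert m S, ∀ x ∈ insert m S, ∀ y ∈ insert m S,
          tri q x y ↔ tri (f' q) (f' x) (f' y)) (hW : Nonempty W) :
    ternary.IsExtensionPair N W := by
  classical
  rw [isExtensionPair_iff_exists_embedding_closure_singleton_sup]
  intro S hS f m
  have hSf : (S : Set N).Finite := @Set.toFinite _ _ hS.finite
  set f₀ : N → W := fun x => if hx : x ∈ S then f ⟨x, hx⟩ else Classical.arbitrary W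
  have hf₀ : ∀ x (hx : x ∈ S), f₀ x = f ⟨x, hx⟩ := fun x hx => dif_pos hx
  have hinj : Set.InjOn f₀ S := by
    intro x hx y hy hxy
    rw [hf₀ x hx, hf₀ y hy] at hxy
    exact congrArg Subtype.val (f.injective hxy)
  have hrel : ∀ q ∈ S, ∀ x ∈ S, ∀ y ∈ S, tri q x y ↔ tri (f₀ q) (f₀ x) (f₀ y) := by
    intro q hq x hx y hy
    rw [hf₀ q hq, hf₀ x hx, hf₀ y hy, embedding_tri, ← embedding_tri S.subtype]
    rfl
  have hext : ∃ f' : N → W, Set.EqOn f' f₀ S ∧ Set.InjOn f' (insert m S) ∧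
      ∀ q ∈ insert m (S : Set N), ∀ x ∈ insert m (S : Set N), ∀ y ∈ insert m (S : Set N),
        tri q x y ↔ tri (f' q) (f' x) (f' y) := by
    by_cases hm : m ∈ (S : Set N)
    · rw [Set.insert_eq_of_mem hm]
      exact ⟨f₀, fun _ _ => rfl, hinj, hrel⟩
    · exact h S f₀ m hSf hinj hrel hm
  obtain ⟨f', hf', hinj', hrel'⟩ := hext
  set T : ternary.Substructure N := Substructure.closure ternary {m} ⊔ S
  have hT : ∀ x ∈ T, x ∈ insert m (S : Set N) := by
    intro x hx
    have hle : T ≤ Substructure.closure ternary (insert m (S : Set N)) :=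
      sup_le (Substructure.closure_mono (by simp))
        (fun y hy => Substructure.subset_closure (Or.inr hy))
    exact (Substructure.mem_closure_iff_of_isRelational _ _ _).1 (hle hx)
  refine ⟨embeddingOf ⟨fun x => f' x, fun x y hxy =>
    Subtype.ext (hinj' (hT _ x.2) (hT _ y.2) hxy)⟩ fun q x y => ?_, ?_⟩
  · refine (hrel' q (hT _ q.2) x (hT _ x.2) y (hT _ y.2)).symm.trans ?_
    exact embedding_tri T.subtype q x y
  · ext x
    exact (hf₀ x x.2).symm.trans (hf' x.2).symm

end Structures

theorem isExtensionPair {G : Type} [Group G] {c : ℕ → PointType G} {i : G × ℕ → ℕ}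
    (hc : ∀ t N, ∃ n, N ≤ n ∧ c n = t) (hi : Function.Injective i)
    {N : Type} [ternary.Structure N] (hr : IsLocalTournament (tri (N := N))) :
    letI := structureOf (rel c i)
    ternary.IsExtensionPair N (G × ℕ) := by
  classical
  let _ := structureOf (rel c i)
  refine isExtensionPair_of_finite (fun S f m hS hf hfr hm => ?_) ⟨(1, 0)⟩
  obtain ⟨b, hb⟩ := exists_extension hc hi hr hS hf hfr hm
  exact ⟨_, fun x hx => Function.update_of_ne (fun h : x = m => hm (h ▸ hx)) _ _, hb⟩

/-- The involution of `ℕ × Bool` exchanging the two points over each element of `a`. -/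
noncomputable def swap (a : Set ℕ) : Equiv.Perm (ℕ × Bool) :=
  open Classical in
  Function.Involutive.toPerm (fun p => (p.1, if p.1 ∈ a then !p.2 else p.2)) (by
    rintro ⟨n, b⟩
    by_cases h : n ∈ a <;> simp [h])

open Classical in
theorem swap_apply (a : Set ℕ) (n : ℕ) (b : Bool) :
    swap a (n, b) = (n, if n ∈ a then !b else b) := rfl

theorem swap_injective : Function.Injective swap := by
  intro a b h
  ext n
  have h' := congrArg (fun e : Equiv.Perm (ℕ × Bool) => e (n, true)) h
  simp only [swap_apply] at h'
  by_cases ha : n ∈ a <;> by_cases hb : n ∈ b <;> simp_all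

theorem swap_swap (a b : Set ℕ) (p : ℕ × Bool) : swap a (swap b (swap a (swap b p))) = p := by
  obtain ⟨n, c⟩ := p
  by_cases ha : n ∈ a <;> by_cases hb : n ∈ b <;> simp [swap_apply, ha, hb]

theorem swap_self (a : Set ℕ) (p : ℕ × Bool) : swap a (swap a p) = p := by
  obtain ⟨n, c⟩ := p
  by_cases ha : n ∈ a <;> simp [swap_apply, ha]

/-- A group in which the involutions fixing some point of a countable set are trivial contains no
copy of the automorphism group of the structure on `ℕ × Bool` with empty relation. -/
theorem not_injective_of_involution {U : Type} [Countable U] [ternary.Structure U] (u : U)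
    (hU : ∀ e : U ≃[ternary] U, e * e = 1 → e u = u → e = 1) :
    letI := structureOf (fun _ _ _ : ℕ × Bool => False)
    ∀ f : ((ℕ × Bool) ≃[ternary] (ℕ × Bool)) →* (U ≃[ternary] U), ¬ Function.Injective f := by
  let _ := structureOf (fun _ _ _ : ℕ × Bool => False)
  intro f hf
  let s (a : Set ℕ) : (ℕ × Bool) ≃[ternary] (ℕ × Bool) := equivOf (swap a) fun _ _ _ => Iff.rfl
  obtain ⟨j, hj⟩ := exists_injective_nat U
  refine Function.cantor_injective (fun a => j (f (s a) u)) fun a b hab => ?_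
  have hu : f (s a) u = f (s b) u := hj hab
  have hself : ∀ a, s a * s a = 1 := fun a => FirstOrder.Language.Equiv.ext (swap_self a)
  have hinv : (s a * s b) * (s a * s b) = 1 := FirstOrder.Language.Equiv.ext (swap_swap a b)
  have h1 : f (s a * s b) = 1 := by
    refine hU _ (by rw [← map_mul, hinv, map_one]) ?_
    rw [map_mul]
    change f (s a) (f (s b) u) = u
    rw [← hu]
    change (f (s a) * f (s a)) u = u
    rw [← map_mul, hself, map_one]
    rfl
  have h2 : s a * s b = 1 := hf (h1.trans (map_one f).symm)
  have h3 : s b = s a := by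
    rw [← one_mul (s b), ← hself a, mul_assoc, h2, mul_one]
  exact swap_injective (_root_.Equiv.ext fun p => (DFunLike.congr_fun h3 p).symm)

/-- The free product of all finite symmetric groups. -/
abbrev SymProduct : Type := Monoid.CoprodI fun n : ℕ => Equiv.Perm (Fin n)

instance : Countable SymProduct := by
  have : Countable (FreeMonoid (Σ n : ℕ, Equiv.Perm (Fin n))) :=
    inferInstanceAs (Countable (List (Σ n : ℕ, Equiv.Perm (Fin n))))
  exact Quotient.countable

theorem exists_hom_symProduct (H : Type) [Group H] [Finite H] :
    ∃ f : H →* SymProduct, Function.Injective f := by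
  obtain ⟨n, ⟨e⟩⟩ := Finite.exists_equiv_fin H
  refine ⟨(Monoid.CoprodI.of (i := n)).comp
    (e.permCongrHom.toMonoidHom.comp (MulAction.toPermHom H H)), ?_⟩
  exact (Monoid.CoprodI.of_injective n).comp
    (e.permCongrHom.injective.comp MulAction.toPerm_injective)

end LocalTournament

open LocalTournament

/-- There is a relational first-order language with finitely many symbols and a Fraïssé
class `K` of finite structures in this language, with Fraïssé limit `U`, such that
(i) every finite group embeds into `Aut U`, and
(ii) `Aut U` is not universal: there is a countable structure `M` whose age is contained
in `K` but whose automorphism group is not isomorphic to any subgroup of `Aut U`. -/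
theorem statement0 :
    ∃ (L : FirstOrder.Language.{0, 0}) (K : Set (Bundled.{0} L.Structure))
      (U : Bundled.{0} L.Structure) (hUc : Countable U)
      (hLc : Countable (Σ l, L.Functions l)),
      L.IsRelational ∧ Finite L.Symbols ∧
      (∀ M ∈ K, Finite M) ∧
      FirstOrder.Language.IsFraisse K ∧
      @FirstOrder.Language.IsFraisseLimit L K U _ hLc hUc ∧
      (∀ (G : Type) [Group G], Finite G →
        ∃ f : G →* (U ≃[L] U), Function.Injective f) ∧
      (∃ M : Bundled.{0} L.Structure, Countable M ∧ L.age M ⊆ K ∧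
        ∀ f : (M ≃[L] M) →* (U ≃[L] U), ¬ Function.Injective f) := by
  obtain ⟨c, hc⟩ := exists_recurrent_sequence (PointType SymProduct)
  obtain ⟨i, hi⟩ := exists_injective_nat (SymProduct × ℕ)
  have hrel := isLocalTournament_rel c hi
  let _ := structureOf (rel c i)
  have hfun : Countable (Σ l, ternary.Functions l) :=
    have : IsEmpty (Σ l, ternary.Functions l) := ⟨fun f => isEmptyElim f.2⟩
    inferInstance
  have hcg : Structure.CG ternary (SymProduct × ℕ) := Structure.cg_of_countable
  have hlim : IsFraisseLimit (ternary.age (SymProduct × ℕ)) (SymProduct × ℕ) :=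
    ⟨(isUltrahomogeneous_iff_IsExtensionPair hcg).2 (isExtensionPair hc hi hrel), rfl⟩
  refine ⟨ternary, ternary.age (SymProduct × ℕ), ⟨SymProduct × ℕ, structureOf (rel c i)⟩,
    inferInstanceAs (Countable (SymProduct × ℕ)), hfun, inferInstance, finite_symbols,
    fun M hM => hM.1.finite, hlim.isFraisse, hlim, fun H _ _ => ?_,
    ⟨ℕ × Bool, structureOf fun _ _ _ => False⟩, inferInstanceAs (Countable (ℕ × Bool)), ?_, ?_⟩
  · obtain ⟨f, hf⟩ := exists_hom_symProduct H
    let e (g : SymProduct) : (SymProduct × ℕ) ≃[ternary] (SymProduct × ℕ) :=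
      equivOf ⟨act g, act g⁻¹, fun x => by simp [← act_mul, act_one],
        fun x => by simp [← act_mul, act_one]⟩ (rel_act c i g)
    refine ⟨⟨⟨fun h => e (f h), ?_⟩, fun g h => ?_⟩, fun g h hgh => hf ?_⟩
    · exact FirstOrder.Language.Equiv.ext fun x => by
        change act (f 1) x = x; rw [map_one, act_one]
    · exact FirstOrder.Language.Equiv.ext fun x => by
        change act (f (g * h)) x = act (f g) (act (f h) x); rw [map_mul, act_mul]
    · have h1 : act (f g) (1, 0) = act (f h) (1, 0) :=
        DFunLike.congr_fun hgh ((1, 0) : SymProduct × ℕ)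
      simpa [act] using h1
  · let _ := structureOf (fun _ _ _ : ℕ × Bool => False)
    have hM : IsLocalTournament (tri (N := ℕ × Bool)) :=
      ⟨fun h => h.elim, fun h => h.elim, fun h => h.elim, fun h => h.elim⟩
    have : IsEmpty ternary.Constants := inferInstanceAs (IsEmpty Empty)
    have : IsEmpty (ternary.Relations 0) := ⟨by rintro ⟨⟩⟩
    obtain ⟨f, -⟩ := embedding_from_cg Structure.cg_of_countable default (isExtensionPair hc hi hM)
    exact f.age_subset_age
  · refine not_injective_of_involution (U := SymProduct × ℕ) (1, 0) fun e he hu => ?_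
    refine FirstOrder.Language.Equiv.ext fun x => ?_
    exact eq_id_of_involutive hc hi (fun y => DFunLike.congr_fun he y)
      (embedding_tri e.toEmbedding) hu x
end

section
/- Let G be a group and K a subgroup of G whose index is strictly less than 2^ℵ₀. If no element of K has order 2, then there is no injective group homomorphism from the group of all subsets of ℕ under symmetric difference into G. -/
/-- The group of all subsets of `α` under symmetric difference, with identity `∅`. -/
def SymmDiffGroup (α : Type*) : Type _ := Set α

instance {α : Type*} : Group (SymmDiffGroup α) where
  mul := fun (A B : Set α) => (symmDiff A B : Set α)
  one := (∅ : Set α)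
  inv := fun (A : Set α) => (A : Set α)
  mul_assoc := fun (a b c : Set α) => symmDiff_assoc a b c
  one_mul := fun (a : Set α) => bot_symmDiff a
  mul_one := fun (a : Set α) => symmDiff_bot a
  inv_mul_cancel := fun (a : Set α) => symmDiff_self a

theorem SymmDiffGroup.mul_self {α : Type*} (A : SymmDiffGroup α) : A * A = 1 :=
  inv_mul_cancel A

theorem SymmDiffGroup.mk_nat : Cardinal.mk (SymmDiffGroup ℕ) = Cardinal.continuum :=
  Cardinal.mk_set_nat

/-- If `K` is a subgroup of `G` of index strictly less than `2^ℵ₀` and no element of `K`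
has order `2`, then the group of all subsets of `ℕ` under symmetric difference does not
embed into `G`. -/
theorem statement3 {G : Type*} [Group G] (K : Subgroup G)
    (hindex : Cardinal.mk (G ⧸ K) < Cardinal.continuum)
    (hK : ∀ g ∈ K, orderOf g ≠ 2) :
    ¬ ∃ f : SymmDiffGroup ℕ →* G, Function.Injective f := by
  rintro ⟨f, hf⟩
  have hinj : Function.Injective fun A => (f A : G ⧸ K) := by
    intro A B hAB
    have hmem : f (A⁻¹ * B) ∈ K := by
      simpa using QuotientGroup.eq.mp hAB
    by_contra hne
    refine hK _ hmem (orderOf_eq_prime ?_ ?_)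
    · rw [← map_pow, pow_two, SymmDiffGroup.mul_self, map_one]
    · rw [Ne, map_eq_one_iff f hf, inv_mul_eq_one]
      exact hne
  have hle := Cardinal.lift_mk_le_lift_mk_of_injective hinj
  rw [SymmDiffGroup.mk_nat, Cardinal.lift_continuum, Cardinal.continuum_le_lift] at hle
  exact hle.not_gt hindex
end

section
/- Let G be a group such that the symmetric group S_∞ of a countably infinite set (i.e., the group of all permutations of ℕ) embeds into G via an injective group homomorphism. Then every subgroup of G whose index is strictly less than 2^ℵ₀ contains an element of order 2. -/
/-- If a subgroup `K` has index less than the cardinality of a group `A`, then every homomorphism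
from `A` maps some nontrivial element into `K`. -/
theorem exists_ne_one_map_mem_of_mk_quotient_lt.{u, v} {A : Type u} {G : Type v} [Group A] [Group G]
    (f : A →* G) (K : Subgroup G)
    (hK : Cardinal.lift.{u} (Cardinal.mk (G ⧸ K)) < Cardinal.lift.{v} (Cardinal.mk A)) :
    ∃ a : A, a ≠ 1 ∧ f a ∈ K := by
  by_contra! h
  refine hK.not_ge (Cardinal.lift_mk_le_lift_mk_of_injective (f := fun a : A ↦ (f a : G ⧸ K)) ?_)
  intro a b hab
  by_contra hne
  refine h (a⁻¹ * b) (fun h1 ↦ hne (inv_mul_eq_one.mp h1)) ?_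
  simpa using QuotientGroup.eq.mp hab

/-- The group of all permutations of `ℕ` contains a direct power of countably many copies of
the group of order `2`. -/
theorem exists_injective_pi_perm_bool_hom :
    ∃ f : (ℕ → Equiv.Perm Bool) →* Equiv.Perm ℕ, Function.Injective f :=
  let e : (Σ _ : ℕ, Bool) ≃ ℕ :=
    (Equiv.sigmaEquivProd ℕ Bool).trans ((Equiv.prodComm ℕ Bool).trans Equiv.boolProdNatEquivNat)
  ⟨e.permCongrHom.toMonoidHom.comp (Equiv.Perm.sigmaCongrRightHom fun _ : ℕ ↦ Bool),
    e.permCongrHom.injective.comp Equiv.Perm.sigmaCongrRightHom_injective⟩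

/-- If the symmetric group `S_∞` of a countably infinite set embeds into a group `G`, then
every subgroup of `G` of index strictly less than `2^ℵ₀` contains an element of order `2`. -/
theorem statement4 {G : Type*} [Group G]
    (h : ∃ f : Equiv.Perm ℕ →* G, Function.Injective f)
    (K : Subgroup G) (hindex : Cardinal.mk (G ⧸ K) < Cardinal.continuum) :
    ∃ g ∈ K, orderOf g = 2 := by
  obtain ⟨f, hf⟩ := h
  obtain ⟨i, hi⟩ := exists_injective_pi_perm_bool_hom
  have hcard : Cardinal.mk (ℕ → Equiv.Perm Bool) = Cardinal.continuum := by
    simp [Fintype.card_perm]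
  obtain ⟨a, ha, hmem⟩ := exists_ne_one_map_mem_of_mk_quotient_lt (f.comp i) K (by
    rw [hcard]; simpa using hindex)
  have hsq : a ^ 2 = 1 := by
    have hbool : ∀ σ : Equiv.Perm Bool, σ ^ 2 = 1 := by decide
    exact funext fun n ↦ hbool (a n)
  refine ⟨_, hmem, ?_⟩
  rw [orderOf_injective (f.comp i) (hf.comp hi)]
  exact orderOf_eq_prime hsq ha
end

section
/- Let 𝓔 and 𝓖 be Fraïssé classes of finite structures in disjoint relational signatures, each having the disjoint amalgamation property. Then their mixed sum 𝓔 ⋈ 𝓖 is a Fraïssé class with the disjoint amalgamation property. -/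
open FirstOrder CategoryTheory FirstOrder.Language

/-- The language of the mixed sum of two relational languages `L1`, `L2`: their (disjoint)
union together with two unary predicates `L` (coded by `true`) and `R` (coded by `false`)
and a binary relation `∼`. -/
def mixLang (L1 L2 : FirstOrder.Language.{0, 0}) : FirstOrder.Language where
  Functions _ := Empty
  Relations n := (L1.Relations n ⊕ L2.Relations n) ⊕
    (match n with
      | 1 => Bool
      | 2 => Unit
      | _ => Empty)

instance (L1 L2 : FirstOrder.Language.{0, 0}) (n : ℕ) :
    IsEmpty ((mixLang L1 L2).Functions n) :=
  inferInstanceAs (IsEmpty Empty)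

variable (L1 L2 : FirstOrder.Language.{0, 0})

/-- The left-side predicate `L`. -/
def mixL {M : Type} [(mixLang L1 L2).Structure M] (x : M) : Prop :=
  Structure.RelMap (L := mixLang L1 L2) (n := 1) (Sum.inr true) ![x]

/-- The right-side predicate `R`. -/
def mixR {M : Type} [(mixLang L1 L2).Structure M] (x : M) : Prop :=
  Structure.RelMap (L := mixLang L1 L2) (n := 1) (Sum.inr false) ![x]

/-- The bipartite edge relation `∼`. -/
def mixAdj {M : Type} [(mixLang L1 L2).Structure M] (x y : M) : Prop :=
  Structure.RelMap (L := mixLang L1 L2) (n := 2) (Sum.inr ()) ![x, y]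

/-- The `L1`-structure induced on the left side `L^M`. -/
def mixLeftStruct [L1.IsRelational] (M : Type) [(mixLang L1 L2).Structure M] :
    L1.Structure {x : M // mixL L1 L2 x} where
  funMap f _ := isEmptyElim f
  RelMap {n} R v := Structure.RelMap (L := mixLang L1 L2) (n := n) (Sum.inl (Sum.inl R))
    (fun i => ((v i : {x : M // mixL L1 L2 x}) : M))

/-- The `L2`-structure induced on the right side `R^M`. -/
def mixRightStruct [L2.IsRelational] (M : Type) [(mixLang L1 L2).Structure M] :
    L2.Structure {x : M // mixR L1 L2 x} where
  funMap f _ := isEmptyElim f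
  RelMap {n} R v := Structure.RelMap (L := mixLang L1 L2) (n := n) (Sum.inl (Sum.inr R))
    (fun i => ((v i : {x : M // mixR L1 L2 x}) : M))

/-- `M` is a mixed sum of a member of `E1` and a member of `E2`: `{L^M, R^M}` partitions
`M`, the `L1`-relations hold only among elements of `L^M` (which forms a structure in `E1`),
the `L2`-relations hold only among elements of `R^M` (which forms a structure in `E2`), and
`∼` is a bipartite graph relation between `L^M` and `R^M`. -/
def MixMem [L1.IsRelational] [L2.IsRelational]
    (E1 : Set (Bundled.{0} L1.Structure)) (E2 : Set (Bundled.{0} L2.Structure))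
    (M : Type) [(mixLang L1 L2).Structure M] : Prop :=
  (∀ x : M, (mixL L1 L2 x ∨ mixR L1 L2 x) ∧ ¬(mixL L1 L2 x ∧ mixR L1 L2 x)) ∧
  (∀ {n : ℕ} (R : L1.Relations n) (v : Fin n → M),
    Structure.RelMap (L := mixLang L1 L2) (Sum.inl (Sum.inl R)) v → ∀ i, mixL L1 L2 (v i)) ∧
  (∀ {n : ℕ} (R : L2.Relations n) (v : Fin n → M),
    Structure.RelMap (L := mixLang L1 L2) (Sum.inl (Sum.inr R)) v → ∀ i, mixR L1 L2 (v i)) ∧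
  (∀ x y : M, mixAdj L1 L2 x y → mixAdj L1 L2 y x) ∧
  (∀ x y : M, mixAdj L1 L2 x y →
    (mixL L1 L2 x ∧ mixR L1 L2 y) ∨ (mixR L1 L2 x ∧ mixL L1 L2 y)) ∧
  (⟨{x : M // mixL L1 L2 x}, mixLeftStruct L1 L2 M⟩ : Bundled.{0} L1.Structure) ∈ E1 ∧
  (⟨{x : M // mixR L1 L2 x}, mixRightStruct L1 L2 M⟩ : Bundled.{0} L2.Structure) ∈ E2

/-- The mixed sum `E1 ⋈ E2` of two classes of finite structures. -/
def mixClass [L1.IsRelational] [L2.IsRelational]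
    (E1 : Set (Bundled.{0} L1.Structure)) (E2 : Set (Bundled.{0} L2.Structure)) :
    Set (Bundled.{0} (mixLang L1 L2).Structure) :=
  {M | Finite M ∧ MixMem L1 L2 E1 E2 M}

/-- Disjoint (strong) amalgamation for a class of structures. -/
def DisjointAmalgamation {L : FirstOrder.Language.{0, 0}} (K : Set (Bundled.{0} L.Structure)) : Prop :=
  ∀ (M N P : Bundled.{0} L.Structure) (MN : M ↪[L] N) (MP : M ↪[L] P),
    M ∈ K → N ∈ K → P ∈ K →
      ∃ (Q : Bundled.{0} L.Structure) (NQ : N ↪[L] Q) (PQ : P ↪[L] Q),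
        Q ∈ K ∧ NQ.comp MN = PQ.comp MP ∧
        ∀ (n : N) (p : P), NQ n = PQ p → ∃ m : M, n = MN m ∧ p = MP m

attribute [local instance] mixLeftStruct mixRightStruct

section MixEmbeddings

variable {L1 L2}

theorem mixLang_relMap_comp_iff {M N : Type} [(mixLang L1 L2).Structure M]
    [(mixLang L1 L2).Structure N] (F : M → N)
    (h1 : ∀ {n : ℕ} (R : L1.Relations n) (v : Fin n → M),
      Structure.RelMap (L := mixLang L1 L2) (Sum.inl (Sum.inl R)) (F ∘ v) ↔
        Structure.RelMap (L := mixLang L1 L2) (Sum.inl (Sum.inl R)) v)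
    (h2 : ∀ {n : ℕ} (R : L2.Relations n) (v : Fin n → M),
      Structure.RelMap (L := mixLang L1 L2) (Sum.inl (Sum.inr R)) (F ∘ v) ↔
        Structure.RelMap (L := mixLang L1 L2) (Sum.inl (Sum.inr R)) v)
    (hL : ∀ x, mixL L1 L2 (F x) ↔ mixL L1 L2 x) (hR : ∀ x, mixR L1 L2 (F x) ↔ mixR L1 L2 x)
    (hA : ∀ x y, mixAdj L1 L2 (F x) (F y) ↔ mixAdj L1 L2 x y) :
    ∀ {n : ℕ} (R : (mixLang L1 L2).Relations n) (v : Fin n → M),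
      Structure.RelMap R (F ∘ v) ↔ Structure.RelMap R v
  | _, .inl (.inl R), v => h1 R v
  | _, .inl (.inr R), v => h2 R v
  | 0, .inr e, _ => Empty.elim e
  | 1, .inr b, v => by
    have e : v = ![v 0] := by ext i; fin_cases i; rfl
    have e' : F ∘ v = ![F (v 0)] := by ext i; fin_cases i; rfl
    rw [e', e]
    cases b
    · exact hR _
    · exact hL _
  | 2, .inr _, v => by
    have e : v = ![v 0, v 1] := by ext i; fin_cases i <;> rfl
    have e' : F ∘ v = ![F (v 0), F (v 1)] := by ext i; fin_cases i <;> rfl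
    rw [e', e]
    exact hA _ _
  | _ + 3, .inr e, _ => Empty.elim e

variable {M N : Type} [(mixLang L1 L2).Structure M] [(mixLang L1 L2).Structure N]
  (e : M ↪[mixLang L1 L2] N)

theorem mixL_embedding_iff (x : M) : mixL L1 L2 (e x) ↔ mixL L1 L2 x := by
  have h := e.map_rel (n := 1) (Sum.inr true) ![x]
  rwa [show e ∘ ![x] = ![e x] by ext i; fin_cases i; rfl] at h

theorem mixR_embedding_iff (x : M) : mixR L1 L2 (e x) ↔ mixR L1 L2 x := by
  have h := e.map_rel (n := 1) (Sum.inr false) ![x]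
  rwa [show e ∘ ![x] = ![e x] by ext i; fin_cases i; rfl] at h

theorem mixAdj_embedding_iff (x y : M) :
    mixAdj L1 L2 (e x) (e y) ↔ mixAdj L1 L2 x y := by
  have h := e.map_rel (n := 2) (Sum.inr ()) ![x, y]
  rwa [show e ∘ ![x, y] = ![e x, e y] by ext i; fin_cases i <;> rfl] at h

/-- The embedding induced on left sides. -/
def mixLeftMap [L1.IsRelational] :
    {x : M // mixL L1 L2 x} ↪[L1] {x : N // mixL L1 L2 x} where
  toFun x := ⟨e x, (mixL_embedding_iff e x).2 x.2⟩
  inj' _ _ h := Subtype.ext (e.injective (congrArg Subtype.val h))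
  map_fun' f := isEmptyElim f
  map_rel' R v := e.map_rel (Sum.inl (Sum.inl R)) (fun i => (v i : M))

/-- The embedding induced on right sides. -/
def mixRightMap [L2.IsRelational] :
    {x : M // mixR L1 L2 x} ↪[L2] {x : N // mixR L1 L2 x} where
  toFun x := ⟨e x, (mixR_embedding_iff e x).2 x.2⟩
  inj' _ _ h := Subtype.ext (e.injective (congrArg Subtype.val h))
  map_fun' f := isEmptyElim f
  map_rel' R v := e.map_rel (Sum.inl (Sum.inr R)) (fun i => (v i : M))

end MixEmbeddings

/-- The disjoint union of `A` and `B`, to be made into a structure with edge relation `E`. -/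
inductive MixSum {A B : Type} (E : A → B → Prop) : Type
  | inl (a : A) : MixSum E
  | inr (b : B) : MixSum E

namespace MixSum

variable {L1 L2} {A B : Type} {E : A → B → Prop}

instance [Finite A] [Finite B] : Finite (MixSum E) :=
  Finite.of_surjective (Sum.elim MixSum.inl MixSum.inr) fun
    | inl a => ⟨.inl a, rfl⟩
    | inr b => ⟨.inr b, rfl⟩

/-- Adjacency in `MixSum E`: the symmetric closure of `E`. -/
def Adj : MixSum E → MixSum E → Prop
  | inl a, inr b => E a b
  | inr b, inl a => E a b
  | _, _ => False

section LiftFun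

variable [L1.IsRelational] [L2.IsRelational]
  {E1 : Set (Bundled.{0} L1.Structure)} {E2 : Set (Bundled.{0} L2.Structure)}
  {N : Type} [(mixLang L1 L2).Structure N]

open Classical in
/-- The map into `MixSum E` given by maps on the two sides. -/
noncomputable def liftFun (hN : MixMem L1 L2 E1 E2 N)
    (f : {x : N // mixL L1 L2 x} → A) (g : {x : N // mixR L1 L2 x} → B) (x : N) : MixSum E :=
  if h : mixL L1 L2 x then inl (f ⟨x, h⟩) else inr (g ⟨x, ((hN.1 x).1).resolve_left h⟩)

theorem liftFun_left (hN : MixMem L1 L2 E1 E2 N)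
    (f : {x : N // mixL L1 L2 x} → A) (g : {x : N // mixR L1 L2 x} → B)
    (x : {x : N // mixL L1 L2 x}) : liftFun (E := E) hN f g x = inl (f x) :=
  dif_pos x.2

theorem liftFun_right (hN : MixMem L1 L2 E1 E2 N)
    (f : {x : N // mixL L1 L2 x} → A) (g : {x : N // mixR L1 L2 x} → B)
    (x : {x : N // mixR L1 L2 x}) : liftFun (E := E) hN f g x = inr (g x) :=
  dif_neg fun h => (hN.1 x).2 ⟨h, x.2⟩

theorem mix_cases (hN : MixMem L1 L2 E1 E2 N) (x : N) :
    (∃ y : {x : N // mixL L1 L2 x}, x = y) ∨ (∃ y : {x : N // mixR L1 L2 x}, x = y) :=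
  (hN.1 x).1.imp (fun h => ⟨⟨x, h⟩, rfl⟩) (fun h => ⟨⟨x, h⟩, rfl⟩)

end LiftFun

variable [L1.Structure A] [L2.Structure B]

/-- The interpretation of the relations of the mixed language in `MixSum E`. -/
def Rel : {n : ℕ} → (mixLang L1 L2).Relations n → (Fin n → MixSum E) → Prop
  | _, .inl (.inl R), v => ∃ w, v = inl ∘ w ∧ Structure.RelMap R w
  | _, .inl (.inr R), v => ∃ w, v = inr ∘ w ∧ Structure.RelMap R w
  | 0, .inr e, _ => Empty.elim e
  | 1, .inr b, v => cond b (∃ a, v 0 = inl a) (∃ a, v 0 = inr a)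
  | 2, .inr _, v => Adj (v 0) (v 1)
  | _ + 3, .inr e, _ => Empty.elim e

instance : (mixLang L1 L2).Structure (MixSum E) where
  funMap f _ := isEmptyElim f
  RelMap := Rel

theorem relMap_left {n : ℕ} (R : L1.Relations n) (v : Fin n → MixSum E) :
    Structure.RelMap (L := mixLang L1 L2) (Sum.inl (Sum.inl R)) v ↔
      ∃ w : Fin n → A, v = inl ∘ w ∧ Structure.RelMap R w := by
  change Rel _ _ ↔ _
  rw [Rel]

theorem relMap_right {n : ℕ} (R : L2.Relations n) (v : Fin n → MixSum E) :
    Structure.RelMap (L := mixLang L1 L2) (Sum.inl (Sum.inr R)) v ↔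
      ∃ w : Fin n → B, v = inr ∘ w ∧ Structure.RelMap R w := by
  change Rel _ _ ↔ _
  rw [Rel]

theorem mixL_iff (x : MixSum E) : mixL L1 L2 x ↔ ∃ a, x = inl a := Iff.rfl

theorem mixR_iff (x : MixSum E) : mixR L1 L2 x ↔ ∃ b, x = inr b := Iff.rfl

theorem mixAdj_iff (x y : MixSum E) : mixAdj L1 L2 x y ↔ Adj x y := Iff.rfl

variable [L1.IsRelational] [L2.IsRelational]

variable (L1 L2 E) in
/-- The left summand is the left side. -/
noncomputable def leftEquiv : A ≃[L1] {x : MixSum E // mixL L1 L2 x} where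
  toEquiv := Equiv.ofBijective (fun a => ⟨inl a, (mixL_iff _).2 ⟨a, rfl⟩⟩) <| by
    refine ⟨fun a b h => MixSum.inl.inj (congrArg Subtype.val h), fun ⟨x, hx⟩ => ?_⟩
    obtain ⟨a, rfl⟩ := (mixL_iff x).1 hx
    exact ⟨a, rfl⟩
  map_fun' f := isEmptyElim f
  map_rel' R v := by
    refine (relMap_left (L1 := L1) (L2 := L2) (E := E) R (inl ∘ v)).trans
      ⟨?_, fun h => ⟨v, rfl, h⟩⟩
    rintro ⟨w, hw, h⟩
    rwa [show v = w from funext fun i => MixSum.inl.inj (congrFun hw i)]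

variable (L1 L2 E) in
/-- The right summand is the right side. -/
noncomputable def rightEquiv : B ≃[L2] {x : MixSum E // mixR L1 L2 x} where
  toEquiv := Equiv.ofBijective (fun b => ⟨inr b, (mixR_iff _).2 ⟨b, rfl⟩⟩) <| by
    refine ⟨fun a b h => MixSum.inr.inj (congrArg Subtype.val h), fun ⟨x, hx⟩ => ?_⟩
    obtain ⟨a, rfl⟩ := (mixR_iff x).1 hx
    exact ⟨a, rfl⟩
  map_fun' f := isEmptyElim f
  map_rel' R v := by
    refine (relMap_right (L1 := L1) (L2 := L2) (E := E) R (inr ∘ v)).trans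
      ⟨?_, fun h => ⟨v, rfl, h⟩⟩
    rintro ⟨w, hw, h⟩
    rwa [show v = w from funext fun i => MixSum.inr.inj (congrFun hw i)]

theorem mem_mixClass {E1 : Set (Bundled.{0} L1.Structure)} {E2 : Set (Bundled.{0} L2.Structure)}
    (hE1 : IsFraisse E1) (hE2 : IsFraisse E2) [Finite A] [Finite B]
    (hA : (⟨A, inferInstance⟩ : Bundled.{0} L1.Structure) ∈ E1)
    (hB : (⟨B, inferInstance⟩ : Bundled.{0} L2.Structure) ∈ E2) :
    (⟨MixSum E, inferInstance⟩ : Bundled.{0} (mixLang L1 L2).Structure) ∈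
      mixClass L1 L2 E1 E2 := by
  refine ⟨inferInstanceAs (Finite (MixSum E)), ?_, ?_, ?_, ?_, ?_,
    (hE1.is_equiv_invariant ⟨leftEquiv L1 L2 E⟩).1 hA,
    (hE2.is_equiv_invariant ⟨rightEquiv L1 L2 E⟩).1 hB⟩
  · change ∀ x : MixSum E, _
    simp only [mixL_iff, mixR_iff]
    rintro (a | b) <;> simp
  · intro n R v h i
    obtain ⟨w, rfl, -⟩ := (relMap_left R v).1 h
    exact ⟨w i, rfl⟩
  · intro n R v h i
    obtain ⟨w, rfl, -⟩ := (relMap_right R v).1 h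
    exact ⟨w i, rfl⟩
  · change ∀ x y : MixSum E, _
    simp only [mixAdj_iff]
    rintro (a | b) (c | d) <;> exact id
  · change ∀ x y : MixSum E, _
    simp only [mixAdj_iff, mixL_iff, mixR_iff]
    rintro (a | b) (c | d) <;> simp [Adj]

section Lift

variable {E1 : Set (Bundled.{0} L1.Structure)} {E2 : Set (Bundled.{0} L2.Structure)}
  {N : Type} [(mixLang L1 L2).Structure N]

/-- Embeddings of the two sides that respect edges assemble to an embedding into `MixSum E`. -/
noncomputable def lift (hN : MixMem L1 L2 E1 E2 N)
    (f : {x : N // mixL L1 L2 x} ↪[L1] A) (g : {x : N // mixR L1 L2 x} ↪[L2] B)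
    (hE : ∀ x y, E (f x) (g y) ↔ mixAdj L1 L2 (x : N) y) : N ↪[mixLang L1 L2] MixSum E where
  toFun := liftFun hN f g
  inj' := by
    intro x y
    obtain ⟨x, rfl⟩ | ⟨x, rfl⟩ := mix_cases hN x <;>
      obtain ⟨y, rfl⟩ | ⟨y, rfl⟩ := mix_cases hN y <;>
      simp [liftFun_left, liftFun_right, Subtype.ext_iff]
  map_fun' f := isEmptyElim f
  map_rel' := by
    refine mixLang_relMap_comp_iff _ ?_ ?_ ?_ ?_ ?_
    · intro n R v
      rw [relMap_left]
      constructor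
      · rintro ⟨w, hw, h⟩
        have hv : ∀ i, ∃ y : {x : N // mixL L1 L2 x}, v i = y := fun i => by
          refine (mix_cases hN (v i)).resolve_right ?_
          rintro ⟨y, hy⟩
          have := congrFun hw i
          simp [hy, liftFun_right] at this
        choose u hu using hv
        have hwu : w = f ∘ u := funext fun i => by
          have := congrFun hw i
          simp only [Function.comp_apply, hu, liftFun_left, MixSum.inl.injEq] at this
          exact this.symm
        rw [hwu, f.map_rel] at h
        rwa [show v = fun i => (u i : N) from funext hu]
      · intro h
        refine ⟨f ∘ fun i => ⟨v i, hN.2.1 R v h i⟩, ?_, (f.map_rel R _).2 h⟩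
        exact funext fun i => liftFun_left hN f g ⟨v i, _⟩
    · intro n R v
      rw [relMap_right]
      constructor
      · rintro ⟨w, hw, h⟩
        have hv : ∀ i, ∃ y : {x : N // mixR L1 L2 x}, v i = y := fun i => by
          refine (mix_cases hN (v i)).resolve_left ?_
          rintro ⟨y, hy⟩
          have := congrFun hw i
          simp [hy, liftFun_left] at this
        choose u hu using hv
        have hwu : w = g ∘ u := funext fun i => by
          have := congrFun hw i
          simp only [Function.comp_apply, hu, liftFun_right, MixSum.inr.injEq] at this
          exact this.symm
        rw [hwu, g.map_rel] at h
        rwa [show v = fun i => (u i : N) from funext hu]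
      · intro h
        refine ⟨g ∘ fun i => ⟨v i, hN.2.2.1 R v h i⟩, ?_, (g.map_rel R _).2 h⟩
        exact funext fun i => liftFun_right hN f g ⟨v i, _⟩
    · intro x
      have := (hN.1 x).2
      obtain ⟨x, rfl⟩ | ⟨x, rfl⟩ := mix_cases hN x
      · simp [liftFun_left, mixL_iff, x.2]
      · simpa [liftFun_right, mixL_iff, x.2] using this
    · intro x
      have := (hN.1 x).2
      obtain ⟨x, rfl⟩ | ⟨x, rfl⟩ := mix_cases hN x
      · simpa [liftFun_left, mixR_iff, x.2] using this
      · simp [liftFun_right, mixR_iff, x.2]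
    · intro x y
      have hx := (hN.1 x).2
      have hy := (hN.1 y).2
      have hxy := hN.2.2.2.2.1 x y
      have hs := Iff.intro (hN.2.2.2.1 x y) (hN.2.2.2.1 y x)
      rw [mixAdj_iff]
      obtain ⟨x, rfl⟩ | ⟨x, rfl⟩ := mix_cases hN x <;>
        obtain ⟨y, rfl⟩ | ⟨y, rfl⟩ := mix_cases hN y <;>
        simp only [liftFun_left, liftFun_right, Adj, hE, hs, false_iff] <;>
        have hx' := x.2 <;> have hy' := y.2 <;> tauto

theorem lift_left (hN : MixMem L1 L2 E1 E2 N)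
    (f : {x : N // mixL L1 L2 x} ↪[L1] A) (g : {x : N // mixR L1 L2 x} ↪[L2] B)
    (hE : ∀ x y, E (f x) (g y) ↔ mixAdj L1 L2 (x : N) y) (x : {x : N // mixL L1 L2 x}) :
    lift hN f g hE x = inl (f x) :=
  liftFun_left hN f g x

theorem lift_right (hN : MixMem L1 L2 E1 E2 N)
    (f : {x : N // mixL L1 L2 x} ↪[L1] A) (g : {x : N // mixR L1 L2 x} ↪[L2] B)
    (hE : ∀ x y, E (f x) (g y) ↔ mixAdj L1 L2 (x : N) y) (x : {x : N // mixR L1 L2 x}) :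
    lift hN f g hE x = inr (g x) :=
  liftFun_right hN f g x

/-- A mixed structure whose sides are isomorphic to `A` and `B` is isomorphic to a `MixSum`. -/
theorem nonempty_equiv (hN : MixMem L1 L2 E1 E2 N)
    (f : {x : N // mixL L1 L2 x} ≃[L1] A) (g : {x : N // mixR L1 L2 x} ≃[L2] B) :
    Nonempty (N ≃[mixLang L1 L2]
      MixSum fun a b => mixAdj L1 L2 (f.symm a : N) (g.symm b : N)) := by
  have hE (x y) : mixAdj L1 L2 (f.symm (f.toEmbedding x) : N) (g.symm (g.toEmbedding y) : N) ↔
      mixAdj L1 L2 (x : N) y := by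
    simp
  let F := lift (E := fun a b => mixAdj L1 L2 (f.symm a : N) (g.symm b : N)) hN
    f.toEmbedding g.toEmbedding hE
  have hF : Function.Surjective F := by
    rintro (a | b)
    · refine ⟨f.symm a, (lift_left hN _ _ hE _).trans ?_⟩
      simp
    · refine ⟨g.symm b, (lift_right hN _ _ hE _).trans ?_⟩
      simp
  exact ⟨{ Equiv.ofBijective F ⟨F.injective, hF⟩ with
    map_fun' := fun f => isEmptyElim f
    map_rel' := F.map_rel }⟩

end Lift

end MixSum

section Classes

variable {L1 L2}

theorem DisjointAmalgamation.exists_disjoint_embeddings {L : FirstOrder.Language.{0, 0}}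
    [L.IsRelational] {K : Set (Bundled.{0} L.Structure)} (hK : IsFraisse K)
    (hd : DisjointAmalgamation K) {N P : Bundled.{0} L.Structure} (hN : N ∈ K) (hP : P ∈ K) :
    ∃ (Q : Bundled.{0} L.Structure) (f : N ↪[L] Q) (g : P ↪[L] Q), Q ∈ K ∧
      ∀ n p, f n ≠ g p := by
  obtain ⟨Q, -, ⟨NQ⟩, ⟨PQ⟩⟩ := hK.jointEmbedding N hN P hP
  let s : L.Structure Empty :=
    { funMap := fun f _ => isEmptyElim f
      RelMap := fun R v => Structure.RelMap (M := N) R fun i => (v i).elim }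
  let i : Empty ↪[L] N :=
    { toFun := Empty.elim
      inj' := fun x => x.elim
      map_fun' := fun f => isEmptyElim f
      map_rel' := fun R v => Iff.rfl }
  let j : Empty ↪[L] P :=
    { toFun := Empty.elim
      inj' := fun x => x.elim
      map_fun' := fun f => isEmptyElim f
      map_rel' := fun R v => by
        rw [← PQ.map_rel, ← i.map_rel, ← NQ.map_rel]
        exact iff_of_eq (congrArg _ (funext fun k => (v k).elim)) }
  have hM : (⟨Empty, s⟩ : Bundled.{0} L.Structure) ∈ K :=
    hK.hereditary N hN ⟨Structure.FG.of_finite, ⟨i⟩⟩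
  obtain ⟨Q', f, g, hQ', -, h⟩ := hd ⟨Empty, s⟩ N P i j hM hN hP
  exact ⟨Q', f, g, hQ', fun n p e => (h n p e).choose.elim⟩

/-- The union of the edges of `N` and `P`, transported along maps of their sides. -/
def gluedEdges {N P A B : Type} [(mixLang L1 L2).Structure N] [(mixLang L1 L2).Structure P]
    (f : {x : N // mixL L1 L2 x} → A) (g : {x : N // mixR L1 L2 x} → B)
    (f' : {x : P // mixL L1 L2 x} → A) (g' : {x : P // mixR L1 L2 x} → B)
    (a : A) (b : B) : Prop :=
  (∃ x y, f x = a ∧ g y = b ∧ mixAdj L1 L2 (x : N) y) ∨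
    ∃ x y, f' x = a ∧ g' y = b ∧ mixAdj L1 L2 (x : P) y

theorem gluedEdges_left_iff {N P A B : Type} [(mixLang L1 L2).Structure N]
    [(mixLang L1 L2).Structure P]
    {f : {x : N // mixL L1 L2 x} → A} {g : {x : N // mixR L1 L2 x} → B}
    {f' : {x : P // mixL L1 L2 x} → A} {g' : {x : P // mixR L1 L2 x} → B}
    (hf : Function.Injective f) (hg : Function.Injective g)
    (h : ∀ x y x' y', f x = f' x' → g y = g' y' →
      (mixAdj L1 L2 (x : N) y ↔ mixAdj L1 L2 (x' : P) y')) (x y) :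
    gluedEdges f g f' g' (f x) (g y) ↔ mixAdj L1 L2 (x : N) y := by
  refine ⟨?_, fun hxy => .inl ⟨x, y, rfl, rfl, hxy⟩⟩
  rintro (⟨u, v, hu, hv, huv⟩ | ⟨u, v, hu, hv, huv⟩)
  · rwa [← hf hu, ← hg hv]
  · exact (h x y u v hu.symm hv.symm).2 huv

theorem gluedEdges_right_iff {N P A B : Type} [(mixLang L1 L2).Structure N]
    [(mixLang L1 L2).Structure P]
    {f : {x : N // mixL L1 L2 x} → A} {g : {x : N // mixR L1 L2 x} → B}
    {f' : {x : P // mixL L1 L2 x} → A} {g' : {x : P // mixR L1 L2 x} → B}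
    (hf' : Function.Injective f') (hg' : Function.Injective g')
    (h : ∀ x y x' y', f x = f' x' → g y = g' y' →
      (mixAdj L1 L2 (x : N) y ↔ mixAdj L1 L2 (x' : P) y')) (x y) :
    gluedEdges f g f' g' (f' x) (g' y) ↔ mixAdj L1 L2 (x : P) y := by
  refine or_comm.trans (gluedEdges_left_iff hf' hg' (f' := f) (g' := g) ?_ x y)
  exact fun x y x' y' hx hy => (h x' y' x y hx.symm hy.symm).symm

variable [L1.IsRelational] [L2.IsRelational]
  {E1 : Set (Bundled.{0} L1.Structure)} {E2 : Set (Bundled.{0} L2.Structure)}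

theorem MixMem.of_embedding (hE1 : IsFraisse E1) (hE2 : IsFraisse E2) {M N : Type} [Finite M]
    [(mixLang L1 L2).Structure M] [(mixLang L1 L2).Structure N] (hN : MixMem L1 L2 E1 E2 N)
    (e : M ↪[mixLang L1 L2] N) : MixMem L1 L2 E1 E2 M := by
  refine ⟨fun x => ?_, fun R v h i => ?_, fun R v h i => ?_, fun x y => ?_, fun x y => ?_,
    hE1.hereditary _ hN.2.2.2.2.2.1 ⟨Structure.FG.of_finite, ⟨mixLeftMap e⟩⟩,
    hE2.hereditary _ hN.2.2.2.2.2.2 ⟨Structure.FG.of_finite, ⟨mixRightMap e⟩⟩⟩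
  · simpa only [mixL_embedding_iff, mixR_embedding_iff] using hN.1 (e x)
  · exact (mixL_embedding_iff e _).1 (hN.2.1 R (e ∘ v) ((e.map_rel _ v).2 h) i)
  · exact (mixR_embedding_iff e _).1 (hN.2.2.1 R (e ∘ v) ((e.map_rel _ v).2 h) i)
  · simpa only [mixAdj_embedding_iff] using hN.2.2.2.1 (e x) (e y)
  · simpa only [mixAdj_embedding_iff, mixL_embedding_iff, mixR_embedding_iff]
      using hN.2.2.2.2.1 (e x) (e y)

theorem mixClass_jointEmbedding (hE1 : IsFraisse E1) (hE2 : IsFraisse E2)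
    (hE1fin : ∀ M ∈ E1, Finite M) (hE2fin : ∀ M ∈ E2, Finite M)
    (hd1 : DisjointAmalgamation E1) (hd2 : DisjointAmalgamation E2) :
    JointEmbedding (mixClass L1 L2 E1 E2) := by
  intro N hN P hP
  obtain ⟨A, f, f', hA, hf⟩ :=
    hd1.exists_disjoint_embeddings hE1 hN.2.2.2.2.2.2.1 hP.2.2.2.2.2.2.1
  obtain ⟨B, g, g', hB, -⟩ :=
    hd2.exists_disjoint_embeddings hE2 hN.2.2.2.2.2.2.2 hP.2.2.2.2.2.2.2
  have := hE1fin A hA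
  have := hE2fin B hB
  have h (x y x' y') (hx : f x = f' x') (_ : g y = g' y') :
      mixAdj L1 L2 (x : N) y ↔ mixAdj L1 L2 (x' : P) y' := (hf x x' hx).elim
  exact ⟨⟨MixSum (gluedEdges f g f' g'), inferInstance⟩, MixSum.mem_mixClass hE1 hE2 hA hB,
    ⟨MixSum.lift hN.2 f g (gluedEdges_left_iff f.injective g.injective h)⟩,
    ⟨MixSum.lift hP.2 f' g' (gluedEdges_right_iff f'.injective g'.injective h)⟩⟩

theorem mixClass_disjointAmalgamation (hE1 : IsFraisse E1) (hE2 : IsFraisse E2)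
    (hE1fin : ∀ M ∈ E1, Finite M) (hE2fin : ∀ M ∈ E2, Finite M)
    (hd1 : DisjointAmalgamation E1) (hd2 : DisjointAmalgamation E2) :
    DisjointAmalgamation (mixClass L1 L2 E1 E2) := by
  intro M N P i j hM hN hP
  obtain ⟨A, f, f', hA, hfc, hf⟩ := hd1 _ _ _ (mixLeftMap i) (mixLeftMap j)
    hM.2.2.2.2.2.2.1 hN.2.2.2.2.2.2.1 hP.2.2.2.2.2.2.1
  obtain ⟨B, g, g', hB, hgc, hg⟩ := hd2 _ _ _ (mixRightMap i) (mixRightMap j)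
    hM.2.2.2.2.2.2.2 hN.2.2.2.2.2.2.2 hP.2.2.2.2.2.2.2
  have := hE1fin A hA
  have := hE2fin B hB
  have h (x y x' y') (hx : f x = f' x') (hy : g y = g' y') :
      mixAdj L1 L2 (x : N) y ↔ mixAdj L1 L2 (x' : P) y' := by
    obtain ⟨m, rfl, rfl⟩ := hf x x' hx
    obtain ⟨m', rfl, rfl⟩ := hg y y' hy
    exact (mixAdj_embedding_iff i _ _).trans (mixAdj_embedding_iff j _ _).symm
  have hl := gluedEdges_left_iff f.injective g.injective h
  have hr := gluedEdges_right_iff f'.injective g'.injective h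
  refine ⟨⟨MixSum (gluedEdges f g f' g'), inferInstance⟩, MixSum.lift hN.2 f g hl,
    MixSum.lift hP.2 f' g' hr, MixSum.mem_mixClass hE1 hE2 hA hB, ?_, ?_⟩
  · ext x
    obtain ⟨x, rfl⟩ | ⟨x, rfl⟩ := MixSum.mix_cases hM.2 x
    · exact (MixSum.lift_left hN.2 f g hl (mixLeftMap i x)).trans <|
        (congrArg _ (DFunLike.congr_fun hfc x)).trans
          (MixSum.lift_left hP.2 f' g' hr (mixLeftMap j x)).symm
    · exact (MixSum.lift_right hN.2 f g hl (mixRightMap i x)).trans <|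
        (congrArg _ (DFunLike.congr_fun hgc x)).trans
          (MixSum.lift_right hP.2 f' g' hr (mixRightMap j x)).symm
  · intro n p hnp
    obtain ⟨n, rfl⟩ | ⟨n, rfl⟩ := MixSum.mix_cases hN.2 n <;>
      obtain ⟨p, rfl⟩ | ⟨p, rfl⟩ := MixSum.mix_cases hP.2 p
    · have e := (MixSum.lift_left hN.2 f g hl n).symm.trans
        (hnp.trans (MixSum.lift_left hP.2 f' g' hr p))
      obtain ⟨m, rfl, rfl⟩ := hf n p (MixSum.inl.inj e)
      exact ⟨m, rfl, rfl⟩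
    · have e := (MixSum.lift_left hN.2 f g hl n).symm.trans
        (hnp.trans (MixSum.lift_right hP.2 f' g' hr p))
      cases e
    · have e := (MixSum.lift_right hN.2 f g hl n).symm.trans
        (hnp.trans (MixSum.lift_left hP.2 f' g' hr p))
      cases e
    · have e := (MixSum.lift_right hN.2 f g hl n).symm.trans
        (hnp.trans (MixSum.lift_right hP.2 f' g' hr p))
      obtain ⟨m, rfl, rfl⟩ := hg n p (MixSum.inr.inj e)
      exact ⟨m, rfl, rfl⟩

theorem mixClass_essentially_countable (hE1 : IsFraisse E1) (hE2 : IsFraisse E2)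
    (hE1fin : ∀ M ∈ E1, Finite M) (hE2fin : ∀ M ∈ E2, Finite M) :
    (Quotient.mk' '' mixClass L1 L2 E1 E2).Countable := by
  have hc : (⋃ c ∈ Quotient.mk' '' E1, ⋃ d ∈ Quotient.mk' '' E2,
      Set.range fun E : c.out → d.out → Prop =>
        (Quotient.mk' (⟨MixSum E, inferInstance⟩ : Bundled.{0} (mixLang L1 L2).Structure) :
          Quotient _)).Countable := by
    refine hE1.is_essentially_countable.biUnion ?_
    rintro _ ⟨A, hA, rfl⟩
    refine hE2.is_essentially_countable.biUnion ?_
    rintro _ ⟨B, hB, rfl⟩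
    obtain ⟨eA⟩ : Nonempty ((Quotient.mk' A).out ≃[L1] A) := Quotient.mk_out A
    obtain ⟨eB⟩ : Nonempty ((Quotient.mk' B).out ≃[L2] B) := Quotient.mk_out B
    have := hE1fin A hA
    have := hE2fin B hB
    have := Finite.of_equiv A eA.symm.toEquiv
    have := Finite.of_equiv B eB.symm.toEquiv
    exact Set.countable_range _
  refine hc.mono ?_
  rintro _ ⟨M, hM, rfl⟩
  let A : Bundled.{0} L1.Structure := ⟨{x : M // mixL L1 L2 x}, mixLeftStruct L1 L2 M⟩
  let B : Bundled.{0} L2.Structure := ⟨{x : M // mixR L1 L2 x}, mixRightStruct L1 L2 M⟩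
  obtain ⟨f⟩ : Nonempty ((Quotient.mk' A).out ≃[L1] A) := Quotient.mk_out A
  obtain ⟨g⟩ : Nonempty ((Quotient.mk' B).out ≃[L2] B) := Quotient.mk_out B
  refine Set.mem_biUnion (Set.mem_image_of_mem _ hM.2.2.2.2.2.2.1) <|
    Set.mem_biUnion (Set.mem_image_of_mem _ hM.2.2.2.2.2.2.2)
      ⟨fun a b => mixAdj L1 L2 (Subtype.val (f a)) (Subtype.val (g b)), ?_⟩
  exact (Quotient.sound (MixSum.nonempty_equiv hM.2 f.symm g.symm)).symm

end Classes

/-- If `E1` and `E2` are Fraïssé classes of finite structures in (disjoint) relational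
signatures, each with the disjoint amalgamation property, then their mixed sum `E1 ⋈ E2`
is a Fraïssé class with the disjoint amalgamation property. -/
theorem statement11 (L1 L2 : FirstOrder.Language.{0, 0}) [L1.IsRelational] [L2.IsRelational]
    (E1 : Set (Bundled.{0} L1.Structure)) (E2 : Set (Bundled.{0} L2.Structure))
    (hE1 : FirstOrder.Language.IsFraisse E1) (hE2 : FirstOrder.Language.IsFraisse E2)
    (hE1fin : ∀ M ∈ E1, Finite M) (hE2fin : ∀ M ∈ E2, Finite M)
    (hdisj1 : DisjointAmalgamation E1) (hdisj2 : DisjointAmalgamation E2) :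
    FirstOrder.Language.IsFraisse (mixClass L1 L2 E1 E2) ∧
    DisjointAmalgamation (mixClass L1 L2 E1 E2) := by
  have hd := mixClass_disjointAmalgamation hE1 hE2 hE1fin hE2fin hdisj1 hdisj2
  refine ⟨⟨?_, ?_, mixClass_essentially_countable hE1 hE2 hE1fin hE2fin, ?_,
    mixClass_jointEmbedding hE1 hE2 hE1fin hE2fin hdisj1 hdisj2, ?_⟩, hd⟩
  · obtain ⟨A, hA⟩ := hE1.is_nonempty
    obtain ⟨B, hB⟩ := hE2.is_nonempty
    have := hE1fin A hA
    have := hE2fin B hB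
    exact ⟨_, MixSum.mem_mixClass (E := fun (_ : A) (_ : B) => False) hE1 hE2 hA hB⟩
  · intro M hM
    have : Finite M := hM.1
    exact Structure.FG.of_finite
  · rintro N hN M ⟨-, ⟨e⟩⟩
    have : Finite N := hN.1
    have : Finite M := Finite.of_injective e e.injective
    exact ⟨this, hN.2.of_embedding hE1 hE2 e⟩
  · intro M N P i j hM hN hP
    obtain ⟨Q, f, g, hQ, h, -⟩ := hd M N P i j hM hN hP
    exact ⟨Q, f, g, hQ, h⟩
end

section
/- Let U be the Fraïssé limit of the Fraïssé class 𝓟𝓒 of finite consumer–product models. Then every finite group is isomorphic to a subgroup of Aut(U), but the symmetric group S_∞ of a countably infinite set does not embed into Aut(U). Since there exists a countable structure M all of whose finite substructures lie in 𝓟𝓒 (namely one consisting of infinitely many consumers and no products) with Aut(M) ≅ S_∞, the group Aut(U) is not universal for 𝓟𝓒. -/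
open FirstOrder CategoryTheory FirstOrder.Language

/-- The language of consumer–product models: two unary predicates `P` (coded by `true`)
and `C` (coded by `false`), and one ternary relation `L`. -/
def pcLang : FirstOrder.Language where
  Functions _ := Empty
  Relations n := match n with
    | 1 => Bool
    | 3 => Unit
    | _ => Empty

instance (n : ℕ) : IsEmpty (pcLang.Functions n) := inferInstanceAs (IsEmpty Empty)

/-- The products predicate `P`. -/
def pcP {M : Type} [pcLang.Structure M] (x : M) : Prop :=
  Structure.RelMap (L := pcLang) (n := 1) (true : Bool) ![x]

/-- The consumers predicate `C`. -/
def pcC {M : Type} [pcLang.Structure M] (x : M) : Prop :=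
  Structure.RelMap (L := pcLang) (n := 1) (false : Bool) ![x]

/-- The relation `x <_c y`, i.e. `L(x, y, c)`. -/
def pcLt {M : Type} [pcLang.Structure M] (x y c : M) : Prop :=
  Structure.RelMap (L := pcLang) (n := 3) (() : Unit) ![x, y, c]

/-- A consumer–product model: `{P, C}` partitions the universe and, for every consumer
`c`, the relation `<_c` is a strict linear order on the set of products. -/
def IsPCModel (M : Type) [pcLang.Structure M] : Prop :=
  (∀ x : M, (pcP x ∨ pcC x) ∧ ¬(pcP x ∧ pcC x)) ∧
  (∀ x y c : M, pcLt x y c → pcP x ∧ pcP y ∧ pcC c) ∧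
  (∀ c : M, pcC c →
    (∀ x : M, ¬ pcLt x x c) ∧
    (∀ x y z : M, pcLt x y c → pcLt y z c → pcLt x z c) ∧
    (∀ x y : M, pcP x → pcP y → x ≠ y → pcLt x y c ∨ pcLt y x c))

/-- The class of all finite consumer–product models. -/
def pcClass : Set (Bundled.{0} pcLang.Structure) :=
  {M | Finite M ∧ IsPCModel M}

/-- The stabilizer `K_c` of an element `c` in the automorphism group. -/
def pcStab (U : Type) [pcLang.Structure U] (c : U) : Subgroup (U ≃[pcLang] U) where
  carrier := {h | h c = c}
  mul_mem' := by
    intro a b ha hb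
    replace ha : a c = c := ha
    replace hb : b c = c := hb
    show (a.comp b) c = c
    rw [FirstOrder.Language.Equiv.comp_apply, hb, ha]
  one_mem' := rfl
  inv_mem' := by
    intro a ha
    replace ha : a c = c := ha
    show a.symm c = c
    nth_rewrite 1 [← ha]
    exact a.symm_apply_apply c

section Generic

open Filter Topology

/-- A family of real rankings of `P`, indexed by `C`, is generic if each ranking is injective and
both its rows and its columns are dense, even after removing finitely many of them. -/
structure IsGenericRank {C P : Type} (r : C → P → ℝ) : Prop where
  injective : ∀ c, Function.Injective (r c)
  exists_product : ∀ E : Set P, E.Finite → ∀ V : Set (C → ℝ), IsOpen V → V.Nonempty →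
    ∃ p ∉ E, (fun c => r c p) ∈ V
  exists_consumer : ∀ E : Set C, E.Finite → ∀ V : Set (P → ℝ), IsOpen V → V.Nonempty →
    ∃ c ∉ E, r c ∈ V

/-- If a point can be approximated by points whose `n`-th coordinate is prescribed, then the
sequence of coordinates of a generic point has dense tails. -/
theorem eventually_residual_dense_tails {X Y : Type*} [TopologicalSpace X] [TopologicalSpace Y]
    [SecondCountableTopology Y] (F : ℕ → X → Y) (hF : ∀ n, Continuous (F n))
    (h : ∀ x y, ∃ u : ℕ → X, Tendsto u atTop (𝓝 x) ∧ ∀ n, F n (u n) = y) :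
    ∀ᶠ x in residual X, ∀ n, ∀ V : Set Y, IsOpen V → V.Nonempty → ∃ k ≥ n, F k x ∈ V := by
  have hB := TopologicalSpace.isBasis_countableBasis Y
  have key : ∀ᶠ x in residual X, ∀ n, ∀ B ∈ TopologicalSpace.countableBasis Y,
      ∃ k ≥ n, F k x ∈ B := by
    rw [eventually_countable_forall]
    intro n
    rw [eventually_countable_ball (TopologicalSpace.countable_countableBasis Y)]
    intro B hBm
    refine residual_of_dense_open (s := {x | ∃ k ≥ n, F k x ∈ B}) ?_ ?_
    · have : {x | ∃ k ≥ n, F k x ∈ B} = ⋃ k ≥ n, F k ⁻¹' B := by ext; simp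
      rw [this]
      exact isOpen_biUnion fun k _ => (hB.isOpen hBm).preimage (hF k)
    · intro x
      obtain ⟨y, hy⟩ := TopologicalSpace.nonempty_of_mem_countableBasis hBm
      obtain ⟨u, hu, huy⟩ := h x y
      refine mem_closure_of_tendsto hu ?_
      filter_upwards [eventually_ge_atTop n] with k hk
      exact ⟨k, hk, by rwa [huy]⟩
  filter_upwards [key] with x hx n V hV hne
  obtain ⟨y, hy⟩ := hne
  obtain ⟨B, hBm, -, hBV⟩ := hB.exists_subset_of_mem_open hy hV
  obtain ⟨k, hk, hkB⟩ := hx n B hBm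
  exact ⟨k, hk, hBV hkB⟩

/-- The ranking of `G × ℕ` by the `g`-translate of the `c`-th row of `R`. -/
def translateRank {G : Type} [Group G] (R : ℕ → G → ℕ → ℝ) (c p : G × ℕ) : ℝ :=
  R c.2 (c.1⁻¹ * p.1) p.2

theorem exists_isGenericRank_translateRank (G : Type) [Group G] [Countable G] :
    ∃ R : ℕ → G → ℕ → ℝ, IsGenericRank (translateRank R) := by
  classical
  have hrow := eventually_residual_dense_tails (X := ℕ → G → ℕ → ℝ) (Y := G × ℕ → ℝ)
    (fun n R p => R n p.1 p.2) (fun n => by fun_prop) (fun R y => by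
      refine ⟨fun n => Function.update R n fun h p => y (h, p), ?_, fun n => by simp⟩
      refine tendsto_pi_nhds.2 fun c => tendsto_const_nhds.congr' ?_
      filter_upwards [eventually_gt_atTop c] with n hn
      rw [Function.update_of_ne hn.ne])
  have hcol := eventually_residual_dense_tails (X := ℕ → G → ℕ → ℝ) (Y := G × ℕ → ℝ)
    (fun n R c => R c.2 c.1⁻¹ n) (fun n => by fun_prop) (fun R y => by
      refine ⟨fun n c h => Function.update (R c h) n (y (h⁻¹, c)), ?_, fun n => by simp⟩
      simp only [tendsto_pi_nhds]
      refine fun c h p => tendsto_const_nhds.congr' ?_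
      filter_upwards [eventually_gt_atTop p] with n hn
      rw [Function.update_of_ne hn.ne])
  have hinj : ∀ᶠ R in residual (ℕ → G → ℕ → ℝ), ∀ (c : ℕ) (p q : G × ℕ), p ≠ q →
      R c p.1 p.2 ≠ R c q.1 q.2 := by
    simp only [eventually_countable_forall]
    rintro c ⟨g, p⟩ ⟨h, q⟩ hpq
    refine residual_of_dense_open (s := {R : ℕ → G → ℕ → ℝ | R c g p ≠ R c h q})
      (isOpen_ne_fun (by fun_prop) (by fun_prop)) fun R => ?_
    have hcont : Continuous fun v : ℝ =>
        Function.update R c (Function.update (R c) g (Function.update (R c g) p v)) := by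
      fun_prop
    have := map_mem_closure hcont (dense_compl_singleton (R c h q) (R c g p))
      (t := {R | R c g p ≠ R c h q}) (fun v hv => by
        rcases eq_or_ne h g with rfl | hgh
        · have : q ≠ p := fun e => hpq (by rw [e])
          simpa [this] using hv
        · simpa [hgh] using hv)
    simpa using this
  obtain ⟨R, hrow, hcol, hinj⟩ := (dense_of_mem_residual (hrow.and (hcol.and hinj))).nonempty
  refine ⟨R, fun c p q hpq => ?_, fun E hE V hV hne => ?_, fun E hE V hV hne => ?_⟩
  · by_contra hne
    refine hinj c.2 (c.1⁻¹ * p.1, p.2) (c.1⁻¹ * q.1, q.2) (fun h => hne ?_) hpq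
    simpa [Prod.ext_iff] using h
  · obtain ⟨n, hn⟩ := (hE.image Prod.snd).bddAbove
    obtain ⟨k, hk, hkV⟩ := hcol (n + 1) V hV hne
    refine ⟨(1, k), fun h => ?_, by simpa [translateRank] using hkV⟩
    have := hn (Set.mem_image_of_mem Prod.snd h)
    simp at this
    omega
  · obtain ⟨n, hn⟩ := (hE.image Prod.snd).bddAbove
    obtain ⟨k, hk, hkV⟩ := hrow (n + 1) V hV hne
    refine ⟨(1, k), fun h => ?_, by convert hkV using 1; ext; simp [translateRank]⟩
    have := hn (Set.mem_image_of_mem Prod.snd h)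
    simp at this
    omega

end Generic

section Models

variable {M N : Type} [pcLang.Structure M] [pcLang.Structure N]

theorem pcP_map (f : M ↪[pcLang] N) (x : M) : pcP (f x) ↔ pcP x := by
  have := f.map_rel (n := 1) (true : Bool) ![x]
  rwa [show f ∘ ![x] = ![f x] by ext i; fin_cases i; rfl] at this

theorem pcC_map (f : M ↪[pcLang] N) (x : M) : pcC (f x) ↔ pcC x := by
  have := f.map_rel (n := 1) (false : Bool) ![x]
  rwa [show f ∘ ![x] = ![f x] by ext i; fin_cases i; rfl] at this

theorem pcLt_map (f : M ↪[pcLang] N) (x y c : M) : pcLt (f x) (f y) (f c) ↔ pcLt x y c := by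
  have := f.map_rel (n := 3) (() : Unit) ![x, y, c]
  rwa [show f ∘ ![x, y, c] = ![f x, f y, f c] by ext i; fin_cases i <;> rfl] at this

theorem relMap_comp_iff {f : M → N} (hP : ∀ x, pcP (f x) ↔ pcP x) (hC : ∀ x, pcC (f x) ↔ pcC x)
    (hL : ∀ x y c, pcLt (f x) (f y) (f c) ↔ pcLt x y c) :
    ∀ {n : ℕ} (R : pcLang.Relations n) (x : Fin n → M),
      Structure.RelMap R (f ∘ x) ↔ Structure.RelMap R x
  | 1, R, x => by
    have hx : x = ![x 0] := by ext i; fin_cases i; rfl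
    have hfx : f ∘ x = ![f (x 0)] := by ext i; fin_cases i; rfl
    rw [hfx, hx]
    match (R : Bool) with
    | true => exact hP (x 0)
    | false => exact hC (x 0)
  | 3, R, x => by
    have hx : x = ![x 0, x 1, x 2] := by ext i; fin_cases i <;> rfl
    have hfx : f ∘ x = ![f (x 0), f (x 1), f (x 2)] := by ext i; fin_cases i <;> rfl
    rw [hfx, hx]
    exact hL (x 0) (x 1) (x 2)
  | 0, R, _ => nomatch (R : Empty)
  | 2, R, _ => nomatch (R : Empty)
  | _ + 4, R, _ => nomatch (R : Empty)

theorem IsPCModel.pcC_iff (h : IsPCModel M) (x : M) : pcC x ↔ ¬ pcP x :=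
  ⟨fun hC hP => (h.1 x).2 ⟨hP, hC⟩, (h.1 x).1.resolve_left⟩

theorem IsPCModel.of_embedding (h : IsPCModel N) (f : M ↪[pcLang] N) : IsPCModel M := by
  refine ⟨fun x => ?_, fun x y c => ?_, fun c hc => ⟨fun x => ?_, fun x y z => ?_, fun x y => ?_⟩⟩
  · simpa only [pcP_map, pcC_map] using h.1 (f x)
  · simpa only [pcP_map, pcC_map, pcLt_map] using h.2.1 (f x) (f y) (f c)
  · simpa only [pcLt_map] using (h.2.2 (f c) ((pcC_map f c).2 hc)).1 (f x)
  · simpa only [pcLt_map] using (h.2.2 (f c) ((pcC_map f c).2 hc)).2.1 (f x) (f y) (f z)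
  · simpa only [pcP_map, pcLt_map, ne_eq, f.injective.eq_iff] using
      (h.2.2 (f c) ((pcC_map f c).2 hc)).2.2 (f x) (f y)

/-- An injection between consumer–product models preserving `P` and `L` is an embedding. -/
def pcEmbedding (hM : IsPCModel M) (hN : IsPCModel N) (f : M → N) (hf : Function.Injective f)
    (hP : ∀ x, pcP (f x) ↔ pcP x) (hL : ∀ x y c, pcLt (f x) (f y) (f c) ↔ pcLt x y c) :
    M ↪[pcLang] N where
  toFun := f
  inj' := hf
  map_fun' F := isEmptyElim F
  map_rel' := relMap_comp_iff hP (fun x => by rw [hM.pcC_iff, hN.pcC_iff, hP]) hL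

/-- A bijection preserving all three relations is an isomorphism. -/
def pcEquiv (e : M ≃ N) (hP : ∀ x, pcP (e x) ↔ pcP x) (hC : ∀ x, pcC (e x) ↔ pcC x)
    (hL : ∀ x y c, pcLt (e x) (e y) (e c) ↔ pcLt x y c) : M ≃[pcLang] N where
  toEquiv := e
  map_fun' F := isEmptyElim F
  map_rel' := relMap_comp_iff hP hC hL

/-- Conjugation by an isomorphism. -/
def autConj (e : M ≃[pcLang] N) : (M ≃[pcLang] M) ≃* (N ≃[pcLang] N) where
  toFun f := e.comp (f.comp e.symm)
  invFun f := e.symm.comp (f.comp e)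
  left_inv f := by ext; simp
  right_inv f := by ext; simp
  map_mul' f g := by
    ext x
    change e (f (g (e.symm x))) = e (f (e.symm (e (g (e.symm x)))))
    rw [e.symm_apply_apply]

/-- The consumer–product model on `C ⊕ P` in which the consumer `c` orders the products by
their rank `r c`. -/
def RankModel {C P : Type} (_r : C → P → ℝ) : Type := C ⊕ P

namespace RankModel

variable {C P : Type} {r : C → P → ℝ}

/-- The element of the model given by a consumer. -/
def consumer (r : C → P → ℝ) (c : C) : RankModel r := Sum.inl c

/-- The element of the model given by a product. -/
def product (r : C → P → ℝ) (p : P) : RankModel r := Sum.inr p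

instance : pcLang.Structure (RankModel r) where
  funMap F := isEmptyElim F
  RelMap {n} := match n with
    | 1 => fun b x => Sum.isRight (x 0) = (b : Bool)
    | 3 => fun _ x => ∃ p q c,
        x 0 = product r p ∧ x 1 = product r q ∧ x 2 = consumer r c ∧ r c p < r c q
    | 0 | 2 | _ + 4 => fun R => nomatch (R : Empty)

instance [Countable C] [Countable P] : Countable (RankModel r) :=
  inferInstanceAs (Countable (C ⊕ P))

theorem eq_consumer_or_product (x : RankModel r) :
    (∃ c, x = consumer r c) ∨ ∃ p, x = product r p := by
  rcases x with c | p
  exacts [.inl ⟨c, rfl⟩, .inr ⟨p, rfl⟩]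

@[simp] theorem consumer_inj {c d : C} : consumer r c = consumer r d ↔ c = d :=
  Sum.inl_injective.eq_iff

@[simp] theorem product_inj {p q : P} : product r p = product r q ↔ p = q :=
  Sum.inr_injective.eq_iff

@[simp] theorem consumer_ne_product (c : C) (p : P) : consumer r c ≠ product r p := Sum.inl_ne_inr

@[simp] theorem product_ne_consumer (c : C) (p : P) : product r p ≠ consumer r c := Sum.inr_ne_inl

@[simp] theorem pcP_product (p : P) : pcP (product r p) := rfl

@[simp] theorem pcC_consumer (c : C) : pcC (consumer r c) := rfl

@[simp] theorem not_pcP_consumer (c : C) : ¬ pcP (consumer r c) := Bool.false_ne_true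

@[simp] theorem not_pcC_product (p : P) : ¬ pcC (product r p) := Bool.false_ne_true.symm

theorem pcLt_iff {x y z : RankModel r} : pcLt x y z ↔
    ∃ p q c, x = product r p ∧ y = product r q ∧ z = consumer r c ∧ r c p < r c q := Iff.rfl

@[simp] theorem pcLt_product_product_consumer {p q : P} {c : C} :
    pcLt (product r p) (product r q) (consumer r c) ↔ r c p < r c q := by
  simp [pcLt_iff]

theorem isPCModel (hr : ∀ c, Function.Injective (r c)) : IsPCModel (RankModel r) := by
  refine ⟨fun x => ?_, fun x y c => ?_, fun c hc => ⟨fun x => ?_, fun x y z => ?_, fun x y => ?_⟩⟩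
  · rcases x.eq_consumer_or_product with ⟨c, rfl⟩ | ⟨p, rfl⟩ <;> simp
  · rintro ⟨p, q, c, rfl, rfl, rfl, -⟩
    simp
  · rintro ⟨p, q, d, rfl, h, rfl, hlt⟩
    obtain rfl := product_inj.1 h
    exact hlt.false
  · rintro ⟨p, q, d, rfl, rfl, rfl, hlt⟩ ⟨p', q', d', h, rfl, h', hlt'⟩
    obtain rfl := product_inj.1 h
    obtain rfl := consumer_inj.1 h'
    simpa using hlt.trans hlt'
  · rcases c.eq_consumer_or_product with ⟨c, rfl⟩ | ⟨p, rfl⟩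
    · rcases x.eq_consumer_or_product with ⟨_, rfl⟩ | ⟨p, rfl⟩ <;>
      rcases y.eq_consumer_or_product with ⟨_, rfl⟩ | ⟨q, rfl⟩ <;> simp
      exact fun h => (hr c).ne h
    · simp at hc

end RankModel

end Models

section Extension

variable {C P : Type} {r : C → P → ℝ}

namespace RankModel

/-- The rank of an element for the consumer `c`; consumers get the value `0`. -/
def rank (c : C) (x : RankModel r) : ℝ := Sum.elim (fun _ => 0) (r c) x

@[simp] theorem rank_product (c : C) (p : P) : rank c (product r p) = r c p := rfl

theorem rank_lt_of_pcLt {x y : RankModel r} {c : C} (h : pcLt x y (consumer r c)) :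
    rank c x < rank c y := by
  obtain ⟨p, q, d, rfl, rfl, hd, hlt⟩ := h
  obtain rfl := consumer_inj.1 hd
  exact hlt

end RankModel

open RankModel

variable {X S : Type} [pcLang.Structure X] [pcLang.Structure S]

theorem IsGenericRank.exists_realization_product (hr : IsGenericRank r) (hX : IsPCModel X)
    [Finite S] (i : S ↪[pcLang] X) (f : S ↪[pcLang] RankModel r) (m : X) :
    ∃ w, (∀ s, f s ≠ w) ∧ pcP w ∧
      (∀ a s, pcLt (i a) m (i s) → pcLt (f a) w (f s)) ∧
      (∀ a s, pcLt m (i a) (i s) → pcLt w (f a) (f s)) := by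
  classical
  have := Fintype.ofFinite S
  let V : Set (C → ℝ) := ⋂ (s : S) (a : S), {v | ∀ c, f s = consumer r c →
    (pcLt (i a) m (i s) → rank c (f a) < v c) ∧ (pcLt m (i a) (i s) → v c < rank c (f a))}
  have hopen : IsOpen V := by
    refine isOpen_iInter_of_finite fun s => isOpen_iInter_of_finite fun a => ?_
    rcases (f s).eq_consumer_or_product with ⟨c, hc⟩ | ⟨p, hp⟩
    · simp only [hc, consumer_inj, forall_eq']
      refine IsOpen.inter (s := {v : C → ℝ | pcLt (i a) m (i s) → rank c (f a) < v c})
        (t := {v : C → ℝ | pcLt m (i a) (i s) → v c < rank c (f a)}) ?_ ?_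
      · by_cases h : pcLt (i a) m (i s)
        · simpa [h] using isOpen_lt (by fun_prop) (by fun_prop)
        · simp [h]
      · by_cases h : pcLt m (i a) (i s)
        · simpa [h] using isOpen_lt (by fun_prop) (by fun_prop)
        · simp [h]
    · simp [hp]
  have hne : V.Nonempty := by
    have : ∀ c, ∃ t : ℝ, ∀ s a, f s = consumer r c →
        (pcLt (i a) m (i s) → rank c (f a) < t) ∧ (pcLt m (i a) (i s) → t < rank c (f a)) := by
      intro c
      by_cases h : ∃ s, f s = consumer r c
      · obtain ⟨s, hs⟩ := h
        obtain ⟨t, hlo, hhi⟩ := Order.exists_between_finsets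
          ((Finset.univ.filter fun a => pcLt (i a) m (i s)).image fun a => rank c (f a))
          ((Finset.univ.filter fun a => pcLt m (i a) (i s)).image fun a => rank c (f a)) (by
            simp only [Finset.mem_image, Finset.mem_filter, Finset.mem_univ, true_and]
            rintro _ ⟨a, ha, rfl⟩ _ ⟨b, hb, rfl⟩
            refine rank_lt_of_pcLt ?_
            rw [← hs, pcLt_map, ← pcLt_map i]
            exact (hX.2.2 _ (hX.2.1 _ _ _ ha).2.2).2.1 _ _ _ ha hb)
        refine ⟨t, fun s' a hs' => ?_⟩
        obtain rfl : s' = s := f.injective (hs'.trans hs.symm)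
        exact ⟨fun h => hlo _ (Finset.mem_image_of_mem _ (by simpa using h)),
          fun h => hhi _ (Finset.mem_image_of_mem _ (by simpa using h))⟩
      · exact ⟨0, fun s _ hs => absurd ⟨s, hs⟩ h⟩
    choose v hv using this
    exact ⟨v, Set.mem_iInter₂.2 fun s a c hc => hv c s a hc⟩
  obtain ⟨p, hpE, hpV⟩ := hr.exists_product (product r ⁻¹' Set.range f)
    ((Set.finite_range f).preimage fun _ _ _ _ h => product_inj.1 h) V hopen hne
  rw [Set.mem_iInter₂] at hpV
  refine ⟨product r p, fun s hs => hpE ⟨s, hs⟩, pcP_product p, fun a s h => ?_, fun a s h => ?_⟩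
  · obtain ⟨hPa, -, hCs⟩ := hX.2.1 _ _ _ h
    rw [pcP_map, ← pcP_map f] at hPa
    rw [pcC_map, ← pcC_map f] at hCs
    obtain ⟨c, hc⟩ | ⟨q, hq⟩ := (f s).eq_consumer_or_product
    · obtain ⟨d, hd⟩ | ⟨q, hq⟩ := (f a).eq_consumer_or_product
      · simp [hd] at hPa
      · have := (hpV s a c hc).1 h
        simpa [hc, hq] using this
    · simp [hq] at hCs
  · obtain ⟨-, hPa, hCs⟩ := hX.2.1 _ _ _ h
    rw [pcP_map, ← pcP_map f] at hPa
    rw [pcC_map, ← pcC_map f] at hCs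
    obtain ⟨c, hc⟩ | ⟨q, hq⟩ := (f s).eq_consumer_or_product
    · obtain ⟨d, hd⟩ | ⟨q, hq⟩ := (f a).eq_consumer_or_product
      · simp [hd] at hPa
      · have := (hpV s a c hc).2 h
        simpa [hc, hq] using this
    · simp [hq] at hCs

theorem IsGenericRank.exists_realization_consumer (hr : IsGenericRank r) (hX : IsPCModel X)
    [Finite S] (i : S ↪[pcLang] X) (f : S ↪[pcLang] RankModel r) {m : X} (hm : pcC m) :
    ∃ w, (∀ s, f s ≠ w) ∧ pcC w ∧ ∀ a b, pcLt (i a) (i b) m → pcLt (f a) (f b) w := by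
  let V : Set (P → ℝ) := ⋂ (a : S) (b : S), {v | ∀ p q, f a = product r p → f b = product r q →
    pcLt (i a) (i b) m → v p < v q}
  have hopen : IsOpen V := by
    refine isOpen_iInter_of_finite fun a => isOpen_iInter_of_finite fun b => ?_
    rcases (f a).eq_consumer_or_product with ⟨c, hc⟩ | ⟨p, hp⟩
    · simp [hc]
    rcases (f b).eq_consumer_or_product with ⟨c, hc⟩ | ⟨q, hq⟩
    · simp [hc]
    by_cases h : pcLt (i a) (i b) m
    · simpa [h, hp, hq] using isOpen_lt (by fun_prop) (by fun_prop)
    · simp [h]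
  have hne : V.Nonempty := by
    refine ⟨fun p => {b : S | ∃ a, f a = product r p ∧ pcLt (i b) (i a) m}.ncard,
      Set.mem_iInter₂.2 fun a b p q hp hq hab => ?_⟩
    have h (x : S) (p : P) (hp : f x = product r p) (b : S) :
        (∃ a, f a = product r p ∧ pcLt (i b) (i a) m) ↔ pcLt (i b) (i x) m := by
      simp [← hp, f.injective.eq_iff]
    simp only [h a p hp, h b q hq, Nat.cast_lt]
    refine Set.ncard_lt_ncard ⟨fun x hx => (hX.2.2 m hm).2.1 _ _ _ hx hab, fun hsub => ?_⟩
    exact (hX.2.2 m hm).1 _ (hsub hab)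
  obtain ⟨c, hcE, hcV⟩ := hr.exists_consumer (consumer r ⁻¹' Set.range f)
    ((Set.finite_range f).preimage fun _ _ _ _ h => consumer_inj.1 h) V hopen hne
  rw [Set.mem_iInter₂] at hcV
  refine ⟨consumer r c, fun s hs => hcE ⟨s, hs⟩, pcC_consumer c, fun a b h => ?_⟩
  obtain ⟨hPa, hPb, -⟩ := hX.2.1 _ _ _ h
  rw [pcP_map, ← pcP_map f] at hPa hPb
  obtain ⟨d, hd⟩ | ⟨p, hp⟩ := (f a).eq_consumer_or_product
  · simp [hd] at hPa
  obtain ⟨d, hd⟩ | ⟨q, hq⟩ := (f b).eq_consumer_or_product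
  · simp [hd] at hPb
  simpa [hp, hq] using hcV a b p q hp hq h

/-- Between consumer–product models, a map which preserves `P` in both directions and `L` in the
forward direction also reflects `L`. -/
theorem pcLt_iff_of_imp {M N : Type} [pcLang.Structure M] [pcLang.Structure N] (hM : IsPCModel M)
    (hN : IsPCModel N) {f : M → N} (hP : ∀ x, pcP (f x) ↔ pcP x)
    (hL : ∀ x y c, pcLt x y c → pcLt (f x) (f y) (f c)) (x y c : M) :
    pcLt (f x) (f y) (f c) ↔ pcLt x y c := by
  refine ⟨fun h => ?_, hL x y c⟩
  obtain ⟨hx, hy, hc⟩ := hN.2.1 _ _ _ h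
  rw [hP] at hx hy
  rw [hN.pcC_iff, hP, ← hM.pcC_iff] at hc
  have hc' := hc
  rw [hM.pcC_iff, ← hP, ← hN.pcC_iff] at hc'
  have hN' := hN.2.2 _ hc'
  rcases eq_or_ne x y with rfl | hxy
  · exact absurd h (hN'.1 _)
  · exact ((hM.2.2 c hc).2.2 x y hx hy hxy).resolve_right fun h' =>
      hN'.1 _ (hN'.2.1 _ _ _ h (hL _ _ _ h'))

theorem IsGenericRank.isExtensionPair (hr : IsGenericRank r) (hX : IsPCModel X) :
    pcLang.IsExtensionPair X (RankModel r) := by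
  classical
  rw [isExtensionPair_iff_exists_embedding_closure_singleton_sup]
  intro S hS f m
  have hR := RankModel.isPCModel hr.injective
  have hSfin : Finite S := hS.finite
  have hmem (x : (Substructure.closure pcLang {m} ⊔ S : pcLang.Substructure X)) :
      x.1 ∈ S ∨ x.1 = m := by
    have hsup : Substructure.closure pcLang {m} ⊔ S =
        Substructure.closure pcLang ({m} ∪ (S : Set X)) := by
      rw [Substructure.closure_union, Substructure.closure_eq]
    have hx := (SetLike.ext_iff.1 hsup x.1).1 x.2
    rw [Substructure.mem_closure_iff_of_isRelational] at hx
    exact hx.symm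
  have hT : IsPCModel (Substructure.closure pcLang {m} ⊔ S : pcLang.Substructure X) :=
    hX.of_embedding (Substructure.subtype _)
  have hval (x y c : (Substructure.closure pcLang {m} ⊔ S : pcLang.Substructure X)) :
      pcLt x y c ↔ pcLt x.1 y.1 c.1 := (pcLt_map (Substructure.subtype _) x y c).symm
  have hvalP (x : (Substructure.closure pcLang {m} ⊔ S : pcLang.Substructure X)) :
      pcP x ↔ pcP x.1 := (pcP_map (Substructure.subtype _) x).symm
  by_cases hmS : m ∈ S
  · have hle : Substructure.closure pcLang {m} ⊔ S ≤ S :=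
      fun x hx => (hmem ⟨x, hx⟩).elim id fun (h : x = m) => h ▸ hmS
    exact ⟨f.comp (Substructure.inclusion hle), by ext; rfl⟩
  obtain ⟨w, hw, hwP, hwL⟩ : ∃ w, (∀ s, f s ≠ w) ∧ (pcP w ↔ pcP m) ∧
      ((∀ a b : S, pcLt a.1 b.1 m → pcLt (f a) (f b) w) ∧
      (∀ a s : S, pcLt a.1 m s.1 → pcLt (f a) w (f s)) ∧
      (∀ a s : S, pcLt m a.1 s.1 → pcLt w (f a) (f s))) := by
    by_cases hm : pcP m
    · obtain ⟨w, hw, hwP, h1, h2⟩ := hr.exists_realization_product hX S.subtype f m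
      exact ⟨w, hw, by simp [hwP, hm],
        fun a b h => ((hX.pcC_iff m).1 (hX.2.1 _ _ _ h).2.2 hm).elim, h1, h2⟩
    · obtain ⟨w, hw, hwC, h⟩ :=
        hr.exists_realization_consumer hX S.subtype f ((hX.pcC_iff m).2 hm)
      exact ⟨w, hw, by simp [(hR.pcC_iff w).1 hwC, hm], h,
        fun a b h => (hm (hX.2.1 _ _ _ h).2.1).elim, fun a b h => (hm (hX.2.1 _ _ _ h).1).elim⟩
  obtain ⟨hw1, hw2, hw3⟩ := hwL
  let g (x : (Substructure.closure pcLang {m} ⊔ S : pcLang.Substructure X)) : RankModel r :=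
    if h : x.1 ∈ S then f ⟨x.1, h⟩ else w
  have hgS {x} (h : x.1 ∈ S) : g x = f ⟨x.1, h⟩ := dif_pos h
  have hgm {x} (h : x.1 = m) : g x = w := dif_neg (by rwa [h])
  have hg : Function.Injective g := by
    intro x y hxy
    rcases hmem x with hx | hx <;> rcases hmem y with hy | hy
    · rw [hgS hx, hgS hy] at hxy
      exact Subtype.ext (congrArg (fun z : S => z.1) (f.injective hxy))
    · rw [hgS hx, hgm hy] at hxy
      exact (hw _ hxy).elim
    · rw [hgm hx, hgS hy] at hxy
      exact (hw _ hxy.symm).elim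
    · exact Subtype.ext (hx.trans hy.symm)
  have hgP x : pcP (g x) ↔ pcP x := by
    rw [hvalP]
    rcases hmem x with hx | hx
    · rw [hgS hx, pcP_map, ← pcP_map S.subtype]
      rfl
    · rw [hgm hx, hwP, hx]
  have hgL x y c (h : pcLt x y c) : pcLt (g x) (g y) (g c) := by
    rw [hval] at h
    rcases hmem x with hx | hx <;> rcases hmem y with hy | hy <;> rcases hmem c with hc | hc
    · rw [hgS hx, hgS hy, hgS hc, pcLt_map, ← pcLt_map S.subtype]
      exact h
    · rw [hgS hx, hgS hy, hgm hc]
      exact hw1 ⟨_, _⟩ ⟨_, _⟩ (by rwa [hc] at h)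
    · rw [hgS hx, hgm hy, hgS hc]
      exact hw2 ⟨_, _⟩ ⟨_, _⟩ (by rwa [hy] at h)
    · rw [hy, hc] at h
      exact ((hX.1 m).2 (hX.2.1 _ _ _ h).2).elim
    · rw [hgm hx, hgS hy, hgS hc]
      exact hw3 ⟨_, _⟩ ⟨_, _⟩ (by rwa [hx] at h)
    · rw [hx, hc] at h
      exact ((hX.1 m).2 ⟨(hX.2.1 _ _ _ h).1, (hX.2.1 _ _ _ h).2.2⟩).elim
    · rw [hx, hy] at h
      exact ((hX.2.2 _ (hX.2.1 _ _ _ h).2.2).1 _ h).elim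
    · rw [hx, hy] at h
      exact ((hX.2.2 _ (hX.2.1 _ _ _ h).2.2).1 _ h).elim
  refine ⟨pcEmbedding hT hR g hg hgP (pcLt_iff_of_imp hT hR hgP hgL), ?_⟩
  ext s
  exact (hgS (x := Substructure.inclusion le_sup_right s) s.2).symm

theorem IsGenericRank.isFraisseLimit [Countable C] [Countable P] (hr : IsGenericRank r) :
    IsFraisseLimit pcClass (RankModel r) where
  ultrahomogeneous := (isUltrahomogeneous_iff_IsExtensionPair Structure.cg_of_countable).2
    (hr.isExtensionPair (RankModel.isPCModel hr.injective))
  age := by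
    ext M
    refine ⟨fun ⟨hfg, ⟨f⟩⟩ => ⟨hfg.finite, (RankModel.isPCModel hr.injective).of_embedding f⟩,
      fun ⟨hfin, hM⟩ => ⟨Structure.FG.of_finite, ?_⟩⟩
    have hbot : (⊥ : pcLang.Substructure M) = Substructure.closure pcLang ∅ :=
      Substructure.closure_empty.symm
    have : IsEmpty (⊥ : pcLang.Substructure M) := ⟨fun x => by
      have hx := (SetLike.ext_iff.1 hbot x.1).1 x.2
      rw [Substructure.mem_closure_iff_of_isRelational] at hx
      exact hx⟩
    have e : (⊥ : pcLang.Substructure M) ↪[pcLang] RankModel r :=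
      pcEmbedding (hM.of_embedding (Substructure.subtype _)) (RankModel.isPCModel hr.injective)
        isEmptyElim (fun x => isEmptyElim x) (fun x => isEmptyElim x) (fun x => isEmptyElim x)
    obtain ⟨f, -⟩ := embedding_from_cg Structure.cg_of_countable
      ⟨⟨⊥, _, e.equivRange⟩, Substructure.fg_bot⟩ (hr.isExtensionPair hM)
    exact ⟨f⟩

end Extension

section Automorphisms

open RankModel

variable {C P : Type} {r : C → P → ℝ}

theorem aut_mul_apply {M : Type} [pcLang.Structure M] (φ ψ : M ≃[pcLang] M) (x : M) :
    (φ * ψ) x = φ (ψ x) := rfl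

/-- An involution of a generic model fixing a consumer is trivial. -/
theorem IsGenericRank.eq_one_of_mul_self (hr : IsGenericRank r)
    {φ : RankModel r ≃[pcLang] RankModel r} (hφ : φ * φ = 1) {c : C}
    (hc : φ (consumer r c) = consumer r c) : φ = 1 := by
  have hR := RankModel.isPCModel hr.injective
  have hinv (x : RankModel r) : φ (φ x) = x := by
    rw [← aut_mul_apply, hφ]
    rfl
  have hmap (x y z : RankModel r) : pcLt (φ x) (φ y) (φ z) ↔ pcLt x y z :=
    pcLt_map φ.toEmbedding x y z
  have hprod (p : P) : φ (product r p) = product r p := by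
    by_contra hne
    obtain ⟨hirr, htrans, htot⟩ := hR.2.2 (consumer r c) (pcC_consumer c)
    have hP : pcP (φ (product r p)) := (pcP_map φ.toEmbedding _).2 (pcP_product p)
    rcases htot _ _ hP (pcP_product p) hne with h | h
    · have h' := (hmap _ _ _).2 h
      rw [hinv, hc] at h'
      exact hirr _ (htrans _ _ _ h h')
    · have h' := (hmap _ _ _).2 h
      rw [hinv, hc] at h'
      exact hirr _ (htrans _ _ _ h h')
  have hsep {d e : C} (hde : d ≠ e) : ∃ p, r d p < 0 ∧ 0 < r e p := by
    classical
    obtain ⟨p, -, hp⟩ := hr.exists_product ∅ Set.finite_empty ({v | v d < 0} ∩ {v | 0 < v e})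
      ((isOpen_lt (by fun_prop) (by fun_prop)).inter (isOpen_lt (by fun_prop) (by fun_prop)))
      ⟨fun k => if k = d then -1 else 1, by simp [hde.symm]⟩
    exact ⟨p, hp⟩
  ext x
  change φ x = x
  obtain ⟨d, rfl⟩ | ⟨p, rfl⟩ := x.eq_consumer_or_product
  · have hC : pcC (φ (consumer r d)) := (pcC_map φ.toEmbedding _).2 (pcC_consumer d)
    obtain ⟨e, he⟩ | ⟨q, hq⟩ := (φ (consumer r d)).eq_consumer_or_product
    · rw [he]
      by_contra hne
      have hde : d ≠ e := fun h => hne (by rw [h])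
      obtain ⟨p, hdp, hep⟩ := hsep hde
      obtain ⟨q, heq, hdq⟩ := hsep hde.symm
      have h := (hmap (product r p) (product r q) (consumer r d)).2
        (pcLt_product_product_consumer.2 (hdp.trans hdq))
      rw [hprod, hprod, he, pcLt_product_product_consumer] at h
      exact (h.trans (heq.trans hep)).false
    · simp [hq] at hC
  · exact hprod p

/-- The involution of `ℕ × Bool` flipping the fibres over the points where `a` is true. -/
def flipPerm (a : ℕ → Bool) : _root_.Equiv.Perm (ℕ × Bool) :=
  Function.Involutive.toPerm (fun x => (x.1, xor (a x.1) x.2)) fun x => by simp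

@[simp] theorem flipPerm_apply (a : ℕ → Bool) (x : ℕ × Bool) :
    flipPerm a x = (x.1, xor (a x.1) x.2) := rfl

theorem flipPerm_mul (a b : ℕ → Bool) :
    flipPerm a * flipPerm b = flipPerm fun n => xor (a n) (b n) := by
  ext x <;> simp

theorem flipPerm_mul_self (a : ℕ → Bool) : flipPerm a * flipPerm a = 1 := by
  ext x <;> simp

theorem flipPerm_injective : Function.Injective flipPerm := fun a b h => by
  funext n
  simpa using congrArg (fun e : _root_.Equiv.Perm (ℕ × Bool) => (e (n, false)).2) h

theorem IsGenericRank.not_exists_perm_embedding [Countable C] [Countable P] [Nonempty C]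
    (hr : IsGenericRank r) :
    ¬ ∃ f : _root_.Equiv.Perm ℕ →* (RankModel r ≃[pcLang] RankModel r), Function.Injective f := by
  rintro ⟨f, hf⟩
  obtain ⟨c⟩ := ‹Nonempty C›
  obtain ⟨e⟩ := nonempty_equiv_of_countable (α := ℕ × Bool) (β := ℕ)
  let F : _root_.Equiv.Perm (ℕ × Bool) →* (RankModel r ≃[pcLang] RankModel r) :=
    f.comp e.permCongrHom.toMonoidHom
  have hF : Function.Injective F := hf.comp e.permCongrHom.injective
  have horbit : Function.Injective fun a => F (flipPerm a) (consumer r c) := by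
    intro a b hab
    have hone : flipPerm b * flipPerm a = 1 := by
      refine (map_eq_one_iff F hF).1 (hr.eq_one_of_mul_self (c := c) ?_ ?_)
      · rw [← map_mul, flipPerm_mul, flipPerm_mul_self, map_one]
      · rw [map_mul, aut_mul_apply]
        refine (congrArg _ hab).trans ?_
        rw [← aut_mul_apply, ← map_mul, flipPerm_mul_self, map_one]
        rfl
    exact flipPerm_injective (mul_left_cancel (hone.trans (flipPerm_mul_self b).symm))
  obtain ⟨g, hg⟩ := exists_injective_nat (RankModel r)
  classical
  refine Function.cantor_injective _ (hg.comp (horbit.comp (g := fun a => _)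
    (f := fun A : Set ℕ => fun n => decide (n ∈ A)) fun A B h => ?_))
  ext n
  simpa using congrFun h n

/-- The action of a group on the model built from translates of a ranking. -/
def translateAut {G : Type} [Group G] (R : ℕ → G → ℕ → ℝ) :
    G →* (RankModel (translateRank R) ≃[pcLang] RankModel (translateRank R)) where
  toFun g := pcEquiv
    (_root_.Equiv.sumCongr ((_root_.Equiv.mulLeft g).prodCongr (_root_.Equiv.refl ℕ))
      ((_root_.Equiv.mulLeft g).prodCongr (_root_.Equiv.refl ℕ)))
    (by rintro (x | x) <;> exact Iff.rfl) (by rintro (x | x) <;> exact Iff.rfl)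
    (by
      rintro (x | x) (y | y) (c | c)
      case inr.inr.inl =>
        change pcLt (product _ (g * x.1, x.2)) (product _ (g * y.1, y.2))
          (consumer _ (g * c.1, c.2)) ↔ pcLt (product _ x) (product _ y) (consumer _ c)
        simp [translateRank, mul_assoc]
      all_goals
        exact iff_of_false (by rintro ⟨_, _, _, ⟨⟩, ⟨⟩, ⟨⟩, -⟩)
          (by rintro ⟨_, _, _, ⟨⟩, ⟨⟩, ⟨⟩, -⟩))
  map_one' := by
    ext x
    rcases x with x | x
    · exact congrArg Sum.inl (Prod.ext (one_mul x.1) rfl)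
    · exact congrArg Sum.inr (Prod.ext (one_mul x.1) rfl)
  map_mul' g h := by
    ext x
    rcases x with x | x
    · exact congrArg Sum.inl (Prod.ext (mul_assoc g h x.1) rfl)
    · exact congrArg Sum.inr (Prod.ext (mul_assoc g h x.1) rfl)

theorem translateAut_injective {G : Type} [Group G] (R : ℕ → G → ℕ → ℝ) :
    Function.Injective (translateAut R) := by
  intro g h hgh
  have := DFunLike.congr_fun hgh (consumer _ (1, 0))
  have := congrArg Prod.fst (Sum.inl_injective this)
  simpa using this

/-- Automorphisms of a model without products are the permutations of its consumers. -/
def autEquivPerm [IsEmpty P] (r : C → P → ℝ) :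
    (RankModel r ≃[pcLang] RankModel r) ≃* _root_.Equiv.Perm C where
  toFun φ := (_root_.Equiv.sumEmpty C P).permCongr φ.toEquiv
  invFun σ := pcEquiv ((_root_.Equiv.sumEmpty C P).symm.permCongr σ)
    (by rintro (x | x); exacts [Iff.rfl, isEmptyElim x])
    (by rintro (x | x); exacts [Iff.rfl, isEmptyElim x])
    (fun _ _ _ => iff_of_false (fun ⟨p, _⟩ => isEmptyElim p) (fun ⟨p, _⟩ => isEmptyElim p))
  left_inv φ := by
    ext x
    rcases x with c | p
    · exact _root_.Equiv.symm_apply_apply (_root_.Equiv.sumEmpty C P) (φ (consumer r c))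
    · exact isEmptyElim p
  right_inv σ := by
    ext x
    rfl
  map_mul' φ ψ := by
    ext x
    exact congrArg (fun y => _root_.Equiv.sumEmpty C P (φ y))
      (_root_.Equiv.symm_apply_apply (_root_.Equiv.sumEmpty C P) _).symm

end Automorphisms

/-- Let `U` be the Fraïssé limit of the class of finite consumer–product models. Then
every finite group embeds into `Aut U`, but `S_∞` does not; since there is a countable
structure (infinitely many consumers, no products) whose age is contained in the class and
whose automorphism group is isomorphic to `S_∞`, the group `Aut U` is not universal. -/
theorem statement16 (U : Type) [pcLang.Structure U] [Countable U]
    (hU : FirstOrder.Language.IsFraisseLimit pcClass U) :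
    (∀ (G : Type) [Group G], Finite G →
      ∃ f : G →* (U ≃[pcLang] U), Function.Injective f) ∧
    (¬ ∃ f : Equiv.Perm ℕ →* (U ≃[pcLang] U), Function.Injective f) ∧
    (∃ M : Bundled.{0} pcLang.Structure, Countable M ∧ pcLang.age M ⊆ pcClass ∧
      Infinite M ∧ (∀ x : M, pcC x) ∧
      Nonempty ((M ≃[pcLang] M) ≃* Equiv.Perm ℕ) ∧
      ¬ ∃ f : (M ≃[pcLang] M) →* (U ≃[pcLang] U), Function.Injective f) := by
  have model (G : Type) [Group G] [Countable G] : ∃ R : ℕ → G → ℕ → ℝ,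
      IsGenericRank (translateRank R) ∧ Nonempty (RankModel (translateRank R) ≃[pcLang] U) := by
    obtain ⟨R, hR⟩ := exists_isGenericRank_translateRank G
    exact ⟨R, hR, hR.isFraisseLimit.nonempty_equiv hU⟩
  have noPerm : ¬ ∃ f : Equiv.Perm ℕ →* (U ≃[pcLang] U), Function.Injective f := by
    rintro ⟨f, hf⟩
    obtain ⟨R, hR, ⟨e⟩⟩ := model Unit
    exact hR.not_exists_perm_embedding ⟨(autConj e).symm.toMonoidHom.comp f,
      (autConj e).symm.injective.comp hf⟩
  refine ⟨fun G _ _ => ?_, noPerm, ?_⟩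
  · obtain ⟨R, -, ⟨e⟩⟩ := model G
    exact ⟨(autConj e).toMonoidHom.comp (translateAut R),
      (autConj e).injective.comp (translateAut_injective R)⟩
  · let r : ℕ → Empty → ℝ := fun _ => Empty.elim
    have hM : IsPCModel (RankModel r) := RankModel.isPCModel fun _ p => p.elim
    refine ⟨Bundled.of (RankModel r), inferInstanceAs (Countable (RankModel r)),
      fun N ⟨hN, ⟨f⟩⟩ => ⟨hN.finite, hM.of_embedding f⟩,
      Infinite.of_injective (RankModel.consumer r) fun _ _ => RankModel.consumer_inj.1,
      fun x => ?_, ⟨autEquivPerm r⟩, fun ⟨f, hf⟩ => ?_⟩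
    · rcases RankModel.eq_consumer_or_product (r := r) x with ⟨c, rfl⟩ | ⟨p, -⟩
      exacts [RankModel.pcC_consumer c, p.elim]
    · exact noPerm ⟨f.comp (autEquivPerm r).symm.toMonoidHom,
        hf.comp (autEquivPerm r).symm.injective⟩
end
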